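/- arXiv:math/0510665 — 3 statements merged into one kernel-verified Lean document; each statement's English description precedes it below -/
import Mathlib

section
/- Let G be an infinite finitely generated nilpotent group with finite symmetric generating set and associated word metric d, and let m ≥ 1 be an integer. Then there are constants c', c > 0 such that for all n > 0 and all t with 1 ≤ t ≤ n/2, the expectation over uniformly random closed lazy words w of length n satisfies c' · t^{m/2} ≤ E(d(e, w(t))^m) ≤ c · t^{m/2}; that is, E(d(e, w(t))^m) = Θ(t^{m/2}). -/
/-!
Statement 9: Let `G` be an infinite finitely generated nilpotent group with finite
symmetric generating set and word metric `d`, and let `m ≥ 1`.  Then there are constants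
`c', c > 0` such that for all `n > 0` and all `t` with `1 ≤ t ≤ n/2`,
`c' · t^(m/2) ≤ E(d(e, w(t))^m) ≤ c · t^(m/2)`, the expectation being over uniformly
random closed lazy words of length `n`.
-/

namespace AvgDehnPaper

variable {G : Type*} [Group G]

/-- The word length of `g` with respect to the (symmetric) generating set `S`:
the least length of a word in the letters of `S` spelling `g`.  For a symmetric
generating set, `d(x, y) = wordLength S (x⁻¹ * y)` is the word metric. -/
noncomputable def wordLength (S : Finset G) (g : G) : ℕ :=
  sInf { k | ∃ l : List G, l.length = k ∧ (∀ x ∈ l, x ∈ S) ∧ l.prod = g }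

/-- The value in `G` of a lazy letter over `S`: `none` is the identity. -/
def lazyVal {S : Finset G} (a : Option {x // x ∈ S}) : G :=
  a.elim 1 Subtype.val

/-- The position `w(t)` of the path spelled by a lazy word `w` after `t` steps. -/
def walkPos {S : Finset G} {n : ℕ} (w : Fin n → Option {x // x ∈ S}) (t : ℕ) : G :=
  (((List.ofFn w).take t).map lazyVal).prod

open scoped Classical in
/-- The (finite, nonempty) set of closed lazy words of length `n` over `S`. -/
noncomputable def closedWalks (S : Finset G) (n : ℕ) :
    Finset (Fin n → Option {x // x ∈ S}) :=
  Finset.univ.filter (fun w => walkPos w n = 1)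

section NilpotentGrowth

open scoped commutatorElement

section WordLength

variable {S : Finset G}

theorem wordLength_prod_le {l : List G} (hl : ∀ x ∈ l, x ∈ S) :
    wordLength S l.prod ≤ l.length :=
  Nat.sInf_le ⟨l, rfl, hl, rfl⟩

theorem wordLength_one : wordLength S (1 : G) = 0 :=
  Nat.le_zero.mp (wordLength_prod_le (S := S) (l := []) (by simp))

theorem wordLength_le_one {s : G} (hs : s ∈ S) : wordLength S s ≤ 1 := by
  simpa using wordLength_prod_le (S := S) (l := [s]) (by simpa using hs)

/-- `S` is closed under inverses and generates `G`. -/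
structure IsSymmGen (S : Finset G) : Prop where
  gen : Subgroup.closure (S : Set G) = ⊤
  inv_mem : ∀ x ∈ S, x⁻¹ ∈ S

namespace IsSymmGen

variable (hS : IsSymmGen S)
include hS

theorem exists_list (g : G) : ∃ l : List G, (∀ x ∈ l, x ∈ S) ∧ l.prod = g := by
  have hg : g ∈ Subgroup.closure (S : Set G) := by rw [hS.gen]; trivial
  induction hg using Subgroup.closure_induction with
  | mem x hx => exact ⟨[x], by simpa using hx, by simp⟩
  | one => exact ⟨[], by simp, rfl⟩
  | mul x y _ _ hx hy =>
    obtain ⟨l, hl, rfl⟩ := hx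
    obtain ⟨l', hl', rfl⟩ := hy
    exact ⟨l ++ l', fun z hz => (List.mem_append.mp hz).elim (hl z) (hl' z), List.prod_append⟩
  | inv x _ hx =>
    obtain ⟨l, hl, rfl⟩ := hx
    refine ⟨(l.map fun x => x⁻¹).reverse, ?_, (List.prod_inv_reverse l).symm⟩
    intro x hx
    simp only [List.mem_reverse, List.mem_map] at hx
    obtain ⟨y, hy, rfl⟩ := hx
    exact hS.inv_mem _ (hl y hy)

theorem exists_list_length_eq (g : G) :
    ∃ l : List G, l.length = wordLength S g ∧ (∀ x ∈ l, x ∈ S) ∧ l.prod = g := by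
  obtain ⟨l, hl, hg⟩ := hS.exists_list g
  exact Nat.sInf_mem (s := { k | ∃ l : List G, l.length = k ∧ (∀ x ∈ l, x ∈ S) ∧ l.prod = g })
    ⟨l.length, l, rfl, hl, hg⟩

theorem wordLength_mul_le (g h : G) :
    wordLength S (g * h) ≤ wordLength S g + wordLength S h := by
  obtain ⟨l, hl, hlS, rfl⟩ := hS.exists_list_length_eq g
  obtain ⟨l', hl', hlS', rfl⟩ := hS.exists_list_length_eq h
  rw [← hl, ← hl', ← List.prod_append, ← List.length_append]
  refine wordLength_prod_le fun x hx => ?_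
  rcases List.mem_append.mp hx with h | h
  exacts [hlS x h, hlS' x h]

theorem wordLength_inv_le (g : G) : wordLength S g⁻¹ ≤ wordLength S g := by
  obtain ⟨l, hl, hlS, rfl⟩ := hS.exists_list_length_eq g
  rw [← hl, List.prod_inv_reverse]
  refine (wordLength_prod_le ?_).trans (by simp)
  intro x hx
  simp only [List.mem_reverse, List.mem_map] at hx
  obtain ⟨y, hy, rfl⟩ := hx
  exact hS.inv_mem _ (hlS y hy)

theorem wordLength_inv (g : G) : wordLength S g⁻¹ = wordLength S g :=
  le_antisymm (hS.wordLength_inv_le g) (by simpa using hS.wordLength_inv_le g⁻¹)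

theorem wordLength_pow_le (g : G) (n : ℕ) : wordLength S (g ^ n) ≤ n * wordLength S g := by
  induction n with
  | zero => simp [wordLength_one]
  | succ n ih =>
    rw [pow_succ, add_mul, one_mul]
    exact (hS.wordLength_mul_le _ _).trans (by gcongr)

theorem wordLength_commutator_le (g h : G) :
    wordLength S ⁅g, h⁆ ≤ 2 * wordLength S g + 2 * wordLength S h := by
  rw [commutatorElement_def]
  have h1 := hS.wordLength_mul_le (g * h * g⁻¹) h⁻¹
  have h2 := hS.wordLength_mul_le (g * h) g⁻¹
  have h3 := hS.wordLength_mul_le g h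
  rw [hS.wordLength_inv] at h1 h2
  omega

theorem finite_ball (r : ℕ) : {g : G | wordLength S g ≤ r}.Finite := by
  refine (List.finite_length_le {x // x ∈ S} r).image (fun l => (l.map Subtype.val).prod)
    |>.subset fun g hg => ?_
  obtain ⟨l, hl, hlS, rfl⟩ := hS.exists_list_length_eq g
  refine ⟨l.attach.map fun x => ⟨x.1, hlS x.1 x.2⟩, ?_, ?_⟩
  · simpa [hl] using hg
  · simp only [List.map_map]
    congr 1
    exact List.attach_map_subtype_val l

end IsSymmGen

end WordLength

section LowerCentralSeries

open Subgroup

theorem commutator_lowerCentralSeries_le (i j : ℕ) :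
    ⁅(⊤ : Subgroup G).lowerCentralSeries i, (⊤ : Subgroup G).lowerCentralSeries j⁆ ≤
      (⊤ : Subgroup G).lowerCentralSeries (i + j + 1) := by
  induction j generalizing i with
  | zero => exact le_rfl
  | succ j ih =>
    set Γ := (⊤ : Subgroup G).lowerCentralSeries with hΓ
    have hbot : ∀ {A : Subgroup G}, A ≤ Γ (i + j + 2) ↔
        A.map (QuotientGroup.mk' (Γ (i + j + 2))) = ⊥ := by
      intro A
      rw [Subgroup.map_eq_bot_iff, QuotientGroup.ker_mk']
    change _ ≤ Γ (i + j + 2)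
    rw [commutator_comm]
    change ⁅⁅Γ j, ⊤⁆, Γ i⁆ ≤ _
    rw [hbot, map_commutator, map_commutator]
    apply commutator_commutator_eq_bot_of_rotate
    · rw [← map_commutator, ← map_commutator, ← hbot, commutator_comm ⊤]
      have h := ih (i + 1)
      rwa [show i + 1 + j + 1 = i + j + 2 by ring] at h
    · rw [← map_commutator, ← map_commutator, ← hbot]
      exact commutator_mono (ih i) le_rfl

/-- `IsComm S n g`: `g` is an iterated commutator, of any shape, of `n` elements of `S`. -/
inductive IsComm (S : Finset G) : ℕ → G → Prop
  | of {s : G} (hs : s ∈ S) : IsComm S 1 s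
  | bracket {i j : ℕ} {g h : G} : IsComm S i g → IsComm S j h → IsComm S (i + j) ⁅g, h⁆

variable {S : Finset G}

theorem IsComm.pos {n : ℕ} {g : G} (h : IsComm S n g) : 1 ≤ n := by
  induction h <;> omega

theorem IsComm.inv (hS : ∀ x ∈ S, x⁻¹ ∈ S) {n : ℕ} {g : G} (h : IsComm S n g) :
    IsComm S n g⁻¹ := by
  cases h with
  | of hs => exact .of (hS _ hs)
  | bracket h1 h2 =>
    rw [commutatorElement_inv, add_comm]
    exact h2.bracket h1

theorem IsComm.mem_lowerCentralSeries {n : ℕ} {g : G} (h : IsComm S n g) :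
    g ∈ (⊤ : Subgroup G).lowerCentralSeries (n - 1) := by
  induction h with
  | of => simp
  | @bracket i j g h hg hh ihg ihh =>
    have := commutator_lowerCentralSeries_le _ _ (commutator_mem_commutator ihg ihh)
    have h1 := hg.pos
    have h2 := hh.pos
    rwa [show i - 1 + (j - 1) + 1 = i + j - 1 by omega] at this

theorem exists_isComm_eq_one (S : Finset G) (hG : Group.IsNilpotent G) :
    ∃ c, ∀ n g, IsComm S n g → c < n → g = 1 := by
  obtain ⟨c, hc⟩ := Subgroup.nilpotent_iff_lowerCentralSeries.mp hG
  refine ⟨c, fun n g h hn => ?_⟩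
  have := Subgroup.lowerCentralSeries_antitone (⊤ : Subgroup G) (show c ≤ n - 1 by omega)
    h.mem_lowerCentralSeries
  rwa [hc, mem_bot] at this

theorem finite_isComm (S : Finset G) (n : ℕ) : {g : G | IsComm S n g}.Finite := by
  induction n using Nat.strong_induction_on with
  | _ n ih =>
    refine (S.finite_toSet.union (Set.Finite.biUnion (Set.finite_lt_nat n) fun i hi =>
      Set.Finite.biUnion (Set.finite_lt_nat n) fun j hj =>
        Set.Finite.image2 (fun g h => ⁅g, h⁆) (ih i hi) (ih j hj))).subset fun g hg => ?_
    cases hg with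
    | of hs => exact .inl hs
    | @bracket i j g h h1 h2 =>
      have := h1.pos
      have := h2.pos
      refine .inr ?_
      simp only [Set.mem_iUnion]
      exact ⟨i, (by omega : i < i + j), j, (by omega : j < i + j), g, h1, h, h2, rfl⟩

end LowerCentralSeries

section WeightedWords

/-- The cost at scale `R` of a word in weighted letters: a letter of weight `n` costs `R⁻ⁿ`. -/
noncomputable def cost (R : ℕ) (l : List (ℕ × G)) : ℝ :=
  (l.map fun z => ((R : ℝ) ^ z.1)⁻¹).sum

/-- `g` is spelled by a word of cost at most `A` in weighted letters from `U`. -/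
def Rep (U : Set (ℕ × G)) (R : ℕ) (A : ℝ) (g : G) : Prop :=
  ∃ l : List (ℕ × G), (∀ z ∈ l, z ∈ U) ∧ (l.map Prod.snd).prod = g ∧ cost R l ≤ A

/-- The iterated commutators of at least `k` elements of `S`, tagged with their weight. -/
def comms (S : Finset G) (k : ℕ) : Set (ℕ × G) := {z | IsComm S z.1 z.2 ∧ k ≤ z.1}

theorem comms_anti {S : Finset G} {i j : ℕ} (h : i ≤ j) : comms S j ⊆ comms S i :=
  fun _ hz => ⟨hz.1, h.trans hz.2⟩

omit [Group G] in
@[simp] theorem cost_nil (R : ℕ) : cost R ([] : List (ℕ × G)) = 0 := rfl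

omit [Group G] in
@[simp] theorem cost_cons (R : ℕ) (z : ℕ × G) (l : List (ℕ × G)) :
    cost R (z :: l) = ((R : ℝ) ^ z.1)⁻¹ + cost R l := by simp [cost]

omit [Group G] in
@[simp] theorem cost_append (R : ℕ) (l l' : List (ℕ × G)) :
    cost R (l ++ l') = cost R l + cost R l' := by simp [cost]

omit [Group G] in
theorem cost_nonneg (R : ℕ) (l : List (ℕ × G)) : 0 ≤ cost R l :=
  List.sum_nonneg fun x hx => by
    obtain ⟨z, -, rfl⟩ := List.mem_map.mp hx
    positivity

variable {U U' : Set (ℕ × G)} {R : ℕ} {A B : ℝ} {g h : G}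

theorem Rep.one (hA : 0 ≤ A) : Rep U R A 1 := ⟨[], by simp, rfl, by simpa⟩

theorem Rep.mul (hg : Rep U R A g) (hh : Rep U R B h) : Rep U R (A + B) (g * h) := by
  obtain ⟨l, hl, rfl, hA⟩ := hg
  obtain ⟨l', hl', rfl, hB⟩ := hh
  refine ⟨l ++ l', fun z hz => (List.mem_append.mp hz).elim (hl z) (hl' z), by simp, ?_⟩
  rw [cost_append]
  exact add_le_add hA hB

theorem Rep.mono (hg : Rep U R A g) (hU : U ⊆ U') (hA : A ≤ B) : Rep U' R B g := by
  obtain ⟨l, hl, rfl, h⟩ := hg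
  exact ⟨l, fun z hz => hU (hl z hz), rfl, h.trans hA⟩

theorem Rep.letter {n : ℕ} (hg : (n, g) ∈ U) : Rep U R ((R : ℝ) ^ n)⁻¹ g :=
  ⟨[(n, g)], by simpa, by simp, by simp⟩

theorem Rep.pow (hg : Rep U R A g) (b : ℕ) : Rep U R (b * A) (g ^ b) := by
  induction b with
  | zero => simpa using Rep.one le_rfl
  | succ b ih =>
    rw [pow_succ]
    convert ih.mul hg using 1
    push_cast; ring

theorem Rep.inv (hU : ∀ z ∈ U, (z.1, z.2⁻¹) ∈ U) (hg : Rep U R A g) : Rep U R A g⁻¹ := by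
  obtain ⟨l, hl, rfl, h⟩ := hg
  refine ⟨(l.map fun z => (z.1, z.2⁻¹)).reverse, ?_, ?_, ?_⟩
  · intro z hz
    simp only [List.mem_reverse, List.mem_map] at hz
    obtain ⟨y, hy, rfl⟩ := hz
    exact hU y (hl y hy)
  · rw [List.prod_inv_reverse, List.map_reverse, List.map_map, List.map_map]
    rfl
  · refine le_trans (le_of_eq ?_) h
    simp [cost, List.sum_reverse, Function.comp_def]

variable {S : Finset G}

theorem Rep.inv_comms (hS : ∀ x ∈ S, x⁻¹ ∈ S) {k : ℕ} (hg : Rep (comms S k) R A g) :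
    Rep (comms S k) R A g⁻¹ :=
  hg.inv fun _ hz => ⟨hz.1.inv hS, hz.2⟩

variable {c : ℕ} (hc : ∀ n g, IsComm S n g → c < n → g = 1)
include hc

theorem exists_rep_commutator_letter (A : ℝ) (hA : 0 ≤ A) : ∃ C : ℝ, 0 ≤ C ∧
    ∀ R : ℕ, ∀ i g, Rep (comms S i) R A g → ∀ n y, IsComm S n y →
      Rep (comms S (i + n)) R (C * ((R : ℝ) ^ n)⁻¹) ⁅g, y⁆ := by
  suffices H : ∀ d, ∃ C : ℝ, 0 ≤ C ∧
      ∀ R : ℕ, ∀ i g, Rep (comms S i) R A g → ∀ n y, IsComm S n y → c < n + d →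
        Rep (comms S (i + n)) R (C * ((R : ℝ) ^ n)⁻¹) ⁅g, y⁆ by
    obtain ⟨C, hC, H⟩ := H (c + 1)
    exact ⟨C, hC, fun R i g hg n y hy => H R i g hg n y hy (by omega)⟩
  intro d
  induction d with
  | zero =>
    refine ⟨0, le_rfl, fun R i g _ n y hy hn => ?_⟩
    rw [hc n y hy hn, commutatorElement_one_right]
    exact Rep.one (by simp)
  | succ d ih =>
    obtain ⟨C, hC, ih⟩ := ih
    refine ⟨(1 + C) * A, by positivity, fun R i g hg n y hy hn => ?_⟩
    obtain ⟨l, hl, rfl, hlA⟩ := hg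
    have key : ∀ l : List (ℕ × G), (∀ z ∈ l, z ∈ comms S i) → cost R l ≤ A →
        Rep (comms S (i + n)) R ((1 + C) * ((R : ℝ) ^ n)⁻¹ * cost R l)
          ⁅(l.map Prod.snd).prod, y⁆ := by
      intro l
      induction l using List.reverseRecOn with
      | nil => intro _ _; simpa using Rep.one le_rfl
      | append_singleton l z ihl =>
        intro hl hlA
        have hz := hl z (by simp)
        have hl' : ∀ z ∈ l, z ∈ comms S i := fun z hz => hl z (by simp [hz])
        have hcost : cost R l ≤ A := by
          refine le_trans ?_ hlA
          simp only [cost_append, cost_cons, cost_nil]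
          have : (0 : ℝ) ≤ ((R : ℝ) ^ z.1)⁻¹ := by positivity
          linarith
        have h1 := ihl hl' hcost
        have hw : IsComm S (z.1 + n) ⁅z.2, y⁆ := hz.1.bracket hy
        have hpos := hz.1.pos
        have h2 := ih R i _ ⟨l, hl', rfl, hcost⟩ _ _ hw (by omega)
        have h3 : Rep (comms S (i + n)) R ((R : ℝ) ^ (z.1 + n))⁻¹ ⁅z.2, y⁆ :=
          Rep.letter ⟨hw, by have := hz.2; simp only; omega⟩
        have h4 := ((h2.mono (comms_anti (by have := hz.2; omega)) le_rfl).mul h3).mul h1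
        convert h4 using 1
        · simp only [cost_append, cost_cons, cost_nil, pow_add, mul_inv]
          ring
        · simp only [List.map_append, List.prod_append, List.map_cons, List.map_nil,
            List.prod_singleton, commutatorElement_def]
          group
    refine (key l hl hlA).mono le_rfl ?_
    rw [mul_right_comm]
    gcongr

theorem exists_rep_conj (A : ℝ) (hA : 0 ≤ A) : ∃ C : ℝ, 0 ≤ C ∧
    ∀ R : ℕ, ∀ g, Rep (comms S 0) R A g → ∀ k ε h, Rep (comms S k) R ε h →
      Rep (comms S k) R (C * ε) (g * h * g⁻¹) := by
  obtain ⟨C, hC, H⟩ := exists_rep_commutator_letter hc A hA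
  refine ⟨C + 1, by positivity, fun R g hg k ε h hh => ?_⟩
  obtain ⟨l, hl, rfl, hlA⟩ := hh
  have key : Rep (comms S k) R ((C + 1) * cost R l) (g * (l.map Prod.snd).prod * g⁻¹) := by
    clear hlA
    induction l with
    | nil => simpa using Rep.one le_rfl
    | cons z l ih =>
      have hz := hl z (by simp)
      have h1 := ih fun z hz => hl z (by simp [hz])
      have h2 := (H R 0 g hg _ _ hz.1).mono 
        (comms_anti (by have := hz.2; omega : k ≤ 0 + z.1)) le_rfl
      have h3 : Rep (comms S k) R ((R : ℝ) ^ z.1)⁻¹ z.2 := Rep.letter hz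
      convert (h2.mul h3).mul h1 using 1
      · rw [cost_cons]; ring
      · simp only [List.map_cons, List.prod_cons, commutatorElement_def]; group
  exact key.mono le_rfl (by gcongr)

theorem exists_rep_commutator (A : ℝ) (hA : 0 ≤ A) : ∃ C : ℝ, 0 ≤ C ∧
    ∀ R : ℕ, ∀ i g, Rep (comms S i) R A g → ∀ j ε h, ε ≤ A → Rep (comms S j) R ε h →
      Rep (comms S (i + j)) R (C * ε) ⁅g, h⁆ := by
  obtain ⟨C, hC, H⟩ := exists_rep_commutator_letter hc A hA
  obtain ⟨D, hD, H'⟩ := exists_rep_conj hc A hA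
  refine ⟨D * C, by positivity, fun R i g hg j ε h hε hh => ?_⟩
  obtain ⟨l, hl, rfl, hlA⟩ := hh
  have key : Rep (comms S (i + j)) R (D * C * cost R l) ⁅g, (l.map Prod.snd).prod⁆ := by
    replace hε := hlA.trans hε
    clear hlA
    induction l using List.reverseRecOn with
    | nil => simpa using Rep.one le_rfl
    | append_singleton l z ih =>
      have hz := hl z (by simp)
      have hl' : ∀ z ∈ l, z ∈ comms S j := fun z hz => hl z (by simp [hz])
      have hcost : cost R l ≤ A := by
        refine le_trans ?_ hε
        simp only [cost_append, cost_cons, cost_nil]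
        have : (0 : ℝ) ≤ ((R : ℝ) ^ z.1)⁻¹ := by positivity
        linarith
      have h1 := ih hl' hcost
      have h2 := (H R i g hg _ _ hz.1).mono
        (comms_anti (by have := hz.2; omega : i + j ≤ i + z.1)) le_rfl
      have h3 := H' R _ ⟨l, fun z hz => comms_anti (Nat.zero_le _) (hl' z hz), rfl, hcost⟩ _ _ _ h2
      convert h1.mul h3 using 1
      · simp only [cost_append, cost_cons, cost_nil]; ring
      · simp only [List.map_append, List.prod_append, List.map_cons, List.map_nil,
          List.prod_singleton, commutatorElement_def]
        group
  exact key.mono le_rfl (by gcongr)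

end WeightedWords

section PowerApproximation

variable {S : Finset G}

theorem natCast_mul_inv_le_one {b N : ℕ} (h : b ≤ N) : (b : ℝ) * (N : ℝ)⁻¹ ≤ 1 := by
  rw [← div_eq_mul_inv]
  exact div_le_one_of_le₀ (by exact_mod_cast h) (by positivity)

theorem IsComm.rep_pow {n : ℕ} {x : G} (hx : IsComm S n x) (R b : ℕ) :
    Rep (comms S n) R (b * ((R : ℝ) ^ n)⁻¹) (x ^ b) :=
  (Rep.letter (U := comms S n) ⟨hx, le_rfl⟩).pow b

theorem IsComm.rep_pow_one {n : ℕ} {x : G} (hx : IsComm S n x) {R b : ℕ} (hb : b ≤ R ^ n) :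
    Rep (comms S n) R 1 (x ^ b) :=
  (hx.rep_pow R b).mono le_rfl (by exact_mod_cast natCast_mul_inv_le_one hb)

variable {c : ℕ} (hc : ∀ n g, IsComm S n g → c < n → g = 1) (hS : IsSymmGen S)
include hc hS

theorem exists_rep_commutator_pow {i j : ℕ} {x y : G} (hx : IsComm S i x) (hy : IsComm S j y) :
    ∃ C : ℝ, 0 ≤ C ∧ ∀ R : ℕ, 1 ≤ R → ∀ p ≤ R ^ i, ∀ q ≤ R ^ j,
      Rep (comms S (i + j + 1)) R C (⁅x ^ p, y ^ q⁆ * (⁅x, y⁆ ^ (p * q))⁻¹) := by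
  obtain ⟨C, hC, HC⟩ := exists_rep_commutator hc 1 zero_le_one
  obtain ⟨D, hD, HD⟩ := exists_rep_conj hc 2 zero_le_two
  refine ⟨D * (C + D * (D * C)), by positivity, fun R hR p hp q hq => ?_⟩
  have ht : IsComm S (i + j) ⁅x, y⁆ := hx.bracket hy
  have hi := hx.pos
  have hj := hy.pos
  have hRpos : (0 : ℝ) < R := by exact_mod_cast hR
  have hR1 : (1 : ℝ) ≤ R := by exact_mod_cast hR
  set t := ⁅x, y⁆ with ht_def
  have hinv : ∀ n : ℕ, ((R : ℝ) ^ n)⁻¹ ≤ 1 := fun n => inv_le_one_of_one_le₀ (one_le_pow₀ hR1)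
  have hstep : ∀ p ≤ R ^ i, (p : ℝ) * ((R : ℝ) ^ (i + j))⁻¹ ≤ ((R : ℝ) ^ j)⁻¹ := by
    intro p hp
    rw [pow_add, mul_inv, ← mul_assoc]
    refine mul_le_of_le_one_left (by positivity) ?_
    exact_mod_cast natCast_mul_inv_le_one hp
  have h1 : ∀ p ≤ R ^ i,
      Rep (comms S (i + j + 1)) R (p * (D * (C * ((R : ℝ) ^ (i + j))⁻¹)))
        ((t ^ p)⁻¹ * ⁅x ^ p, y⁆) := by
    intro p
    induction p with
    | zero => intro _; simpa using Rep.one le_rfl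
    | succ p ih =>
      intro hp
      have hp' : p ≤ R ^ i := by omega
      have e1 := HC R i _ (hx.rep_pow_one hp') (i + j) _ _ (hinv _)
        (Rep.letter (U := comms S (i + j)) ⟨ht, le_rfl⟩)
      have e2 : Rep (comms S 0) R 2 (t ^ (p + 1))⁻¹ := by
        refine ((ht.rep_pow R (p + 1)).inv_comms hS.inv_mem).mono (comms_anti (Nat.zero_le _)) ?_
        have := hstep (p + 1) hp
        have := hinv j
        linarith
      have e3 := (HD R _ e2 _ _ _ e1).mono
        (comms_anti (by omega : i + j + 1 ≤ i + (i + j))) le_rfl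
      convert e3.mul (ih hp') using 1
      · push_cast; ring
      · have hcomm : ⁅x ^ (p + 1), y⁆ = ⁅x ^ p, t⁆ * t * ⁅x ^ p, y⁆ := by
          rw [ht_def]
          simp only [commutatorElement_def, pow_succ]
          group
        rw [hcomm]
        generalize ⁅x ^ p, t⁆ = a
        generalize ⁅x ^ p, y⁆ = b
        clear_value t
        group
  induction q with
  | zero => simpa using Rep.one (by positivity)
  | succ q _ =>
    have key : ∀ q ≤ R ^ j, Rep (comms S (i + j + 1)) R
        (q * (D * (C * ((R : ℝ) ^ j)⁻¹ + D * (D * C * ((R : ℝ) ^ j)⁻¹))))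
        (⁅x ^ p, y ^ q⁆ * (t ^ (p * q))⁻¹) := by
      intro q
      induction q with
      | zero => intro _; simpa using Rep.one le_rfl
      | succ q ih =>
        intro hq
        have hq' : q ≤ R ^ j := by omega
        have e1 : Rep (comms S (i + j + 1)) R (D * C * ((R : ℝ) ^ j)⁻¹)
            ((t ^ p)⁻¹ * ⁅x ^ p, y⁆) := by
          refine (h1 p hp).mono le_rfl ?_
          have := mul_le_mul_of_nonneg_left (hstep p hp) (mul_nonneg hD hC)
          linarith
        have hty : Rep (comms S 0) R 2 (t ^ p * y ^ q) := by
          refine (((ht.rep_pow R p).mono (comms_anti (Nat.zero_le _)) ((hstep p hp).trans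
            (hinv j))).mul ((hy.rep_pow_one hq').mono (comms_anti (Nat.zero_le _)) le_rfl)).mono
              le_rfl ?_
          norm_num
        have e2 := HD R _ hty _ _ _ e1
        have e3 := (HC R j _ (hy.rep_pow_one hq') (i + j) _ _ (hinv j)
          ((ht.rep_pow R p).mono le_rfl (hstep p hp))).mono
            (comms_anti (by omega : i + j + 1 ≤ j + (i + j))) le_rfl
        have htpq : Rep (comms S 0) R 2 (t ^ (p * q)) := by
          refine (ht.rep_pow_one (R := R) (b := p * q) ?_).mono (comms_anti (Nat.zero_le _))
            one_le_two
          rw [pow_add]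
          exact Nat.mul_le_mul hp hq'
        convert (ih hq').mul (HD R _ htpq _ _ _ (e3.mul e2)) using 1
        · push_cast; ring
        · rw [mul_add, mul_one, pow_add]
          simp only [commutatorElement_def, pow_succ]
          group
    refine (key (q + 1) hq).mono le_rfl ?_
    have h2 : ((q + 1 : ℕ) : ℝ) * ((R : ℝ) ^ j)⁻¹ ≤ 1 := by
      exact_mod_cast natCast_mul_inv_le_one hq
    have := mul_le_mul_of_nonneg_left h2
      (show 0 ≤ D * (C + D * (D * C)) by positivity)
    linarith

theorem exists_rep_commutator_approx {i j : ℕ} {x y : G} (hx : IsComm S i x) (hy : IsComm S j y)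
    {A : ℝ} (hA : 0 ≤ A) : ∃ C : ℝ, 0 ≤ C ∧ ∀ R : ℕ, 1 ≤ R → ∀ p ≤ R ^ i, ∀ q ≤ R ^ j, ∀ h k : G,
      Rep (comms S (i + 1)) R A (h * (x ^ p)⁻¹) → Rep (comms S (j + 1)) R A (k * (y ^ q)⁻¹) →
      Rep (comms S (i + j + 1)) R C (⁅h, k⁆ * (⁅x, y⁆ ^ (p * q))⁻¹) := by
  obtain ⟨B, hB, HB⟩ := exists_rep_commutator_pow hc hS hx hy
  obtain ⟨C, hC, HC⟩ := exists_rep_commutator hc (A + A + 1) (by positivity)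
  obtain ⟨D, hD, HD⟩ := exists_rep_conj hc (A + A + 1) (by positivity)
  refine ⟨D * (C * A) + D * B + C * 1 + D * (C * (A + 1)), by positivity,
    fun R hR p hp q hq h k hE hF => ?_⟩
  have ht : IsComm S (i + j) ⁅x, y⁆ := hx.bracket hy
  have hP := HB R hR p hp q hq
  have hpq : p * q ≤ R ^ (i + j) := by rw [pow_add]; exact Nat.mul_le_mul hp hq
  have hT := ht.rep_pow_one hpq
  have hX := hx.rep_pow_one hp
  have hY := hy.rep_pow_one hq
  set E := h * (x ^ p)⁻¹ with hE_def
  set F := k * (y ^ q)⁻¹ with hF_def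
  set T := ⁅x, y⁆ ^ (p * q) with hT_def
  have hEF := (hE.mono (comms_anti (by omega : 1 ≤ i + 1)) le_rfl).mul
    (hF.mono (comms_anti (by omega : 1 ≤ j + 1)) le_rfl)
  have hk : Rep (comms S j) R (A + 1) k := by
    convert (hF.mono (comms_anti (by omega : j ≤ j + 1)) le_rfl).mul hY using 1
    rw [hF_def]; group
  have e1 := HC R i _ (hX.mono le_rfl (by linarith)) _ _ _ (by linarith) hF
  have e1' := HD R _ (hE.mono (comms_anti (Nat.zero_le _)) (by linarith)) _ _ _ e1
  have e2 := HD R _ (hEF.mono (comms_anti (Nat.zero_le _)) (by linarith)) _ _ _ hP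
  have e3 := HC R 1 _ (hEF.mono le_rfl (by linarith)) _ _ _ (by linarith) hT
  have e4 := HC R _ _ (hE.mono le_rfl (by linarith)) _ _ _ (by linarith) hk
  have e4' := HD R _ (hT.mono (comms_anti (Nat.zero_le _)) (by linarith)) _ _ _ e4
  convert (((e1'.mono (comms_anti (by omega : i + j + 1 ≤ i + (j + 1))) le_rfl).mul e2).mul
    (e3.mono (comms_anti (by omega : i + j + 1 ≤ 1 + (i + j))) le_rfl)).mul
    (e4'.mono (comms_anti (by omega : i + j + 1 ≤ i + 1 + j)) le_rfl) using 1
  rw [hE_def, hF_def]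
  simp only [commutatorElement_def]
  group

theorem IsComm.exists_short_approx {n : ℕ} {z : G} (hz : IsComm S n z) :
    ∃ (C : ℕ) (A : ℝ), 0 ≤ A ∧ ∀ R : ℕ, 1 ≤ R → ∀ b ≤ R ^ n, ∃ h : G,
      wordLength S h ≤ C * R ∧ Rep (comms S (n + 1)) R A (h * (z ^ b)⁻¹) := by
  induction hz with
  | @of s hs =>
    refine ⟨1, 0, le_rfl, fun R _ b hb => ⟨s ^ b, ?_, ?_⟩⟩
    · calc wordLength S (s ^ b) ≤ b * wordLength S s := hS.wordLength_pow_le _ _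
        _ ≤ b * 1 := by gcongr; exact wordLength_le_one hs
        _ ≤ 1 * R := by simpa using hb
    · rw [mul_inv_cancel]
      exact Rep.one le_rfl
  | @bracket i j x y hx hy ihx ihy =>
    obtain ⟨Cx, Ax, hAx, ihx⟩ := ihx
    obtain ⟨Cy, Ay, hAy, ihy⟩ := ihy
    obtain ⟨B, hB, HB⟩ := exists_rep_commutator_approx hc hS hx hy (add_nonneg hAx hAy)
    obtain ⟨D, hD, HD⟩ := exists_rep_conj hc 1 zero_le_one
    refine ⟨4 * Cx + 4 * Cy, B + D * B, by positivity, fun R hR b hb => ?_⟩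
    have hRi : 0 < R ^ i := by positivity
    have hRj : 1 ≤ R ^ j := Nat.one_le_pow _ _ hR
    have hq : b / R ^ i ≤ R ^ j := by
      apply Nat.div_le_of_le_mul
      rwa [← pow_add]
    have hr : b % R ^ i ≤ R ^ i := (Nat.mod_lt _ hRi).le
    obtain ⟨h₁, hl₁, hr₁⟩ := ihx R hR (R ^ i) le_rfl
    obtain ⟨k₁, kl₁, kr₁⟩ := ihy R hR _ hq
    obtain ⟨h₂, hl₂, hr₂⟩ := ihx R hR _ hr
    obtain ⟨k₂, kl₂, kr₂⟩ := ihy R hR 1 hRj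
    have hx' : ∀ {g}, Rep (comms S (i + 1)) R Ax g → Rep (comms S (i + 1)) R (Ax + Ay) g :=
      fun h => h.mono le_rfl (by linarith)
    have hy' : ∀ {g}, Rep (comms S (j + 1)) R Ay g → Rep (comms S (j + 1)) R (Ax + Ay) g :=
      fun h => h.mono le_rfl (by linarith)
    have e1 := HB R hR _ le_rfl _ hq _ _ (hx' hr₁) (hy' kr₁)
    have e2 := HB R hR _ hr _ hRj _ _ (hx' hr₂) (hy' kr₂)
    refine ⟨⁅h₁, k₁⁆ * ⁅h₂, k₂⁆, ?_, ?_⟩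
    · have w1 := hS.wordLength_mul_le ⁅h₁, k₁⁆ ⁅h₂, k₂⁆
      have w2 := hS.wordLength_commutator_le h₁ k₁
      have w3 := hS.wordLength_commutator_le h₂ k₂
      have : (4 * Cx + 4 * Cy) * R = 4 * (Cx * R) + 4 * (Cy * R) := by ring
      omega
    · have hle : R ^ i * (b / R ^ i) ≤ R ^ (i + j) := (Nat.mul_div_le _ _).trans hb
      have e3 := HD R _ (((hx.bracket hy).rep_pow_one hle).mono
        (comms_anti (Nat.zero_le _)) le_rfl) _ _ _ e2
      convert e1.mul e3 using 1
      conv_lhs => rw [← Nat.div_add_mod b (R ^ i), pow_add]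
      rw [mul_one]
      group

end PowerApproximation

section Covering

variable {S : Finset G} {c : ℕ} (hc : ∀ n g, IsComm S n g → c < n → g = 1) (hS : IsSymmGen S)

include hS in
theorem IsComm.rep_zpow {n : ℕ} {x : G} (hx : IsComm S n x) (R : ℕ) (e : ℤ) :
    Rep (comms S n) R (|(e : ℝ)| * ((R : ℝ) ^ n)⁻¹) (x ^ e) := by
  obtain ⟨k, rfl | rfl⟩ := e.eq_nat_or_neg
  · simpa using hx.rep_pow R k
  · simpa using (hx.rep_pow R k).inv_comms hS.inv_mem

include hc hS in
theorem exists_rep_extract {V : Set (ℕ × G)} (hV : ∀ z ∈ V, IsComm S z.1 z.2) {n : ℕ} {x : G}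
    (hx : (n, x) ∈ V) (hup : ∀ y : ℕ × G, IsComm S y.1 y.2 → n < y.1 → y ∈ V)
    (A : ℝ) (hA : 0 ≤ A) :
    ∃ C : ℝ, 0 ≤ C ∧ ∀ R : ℕ, 1 ≤ R → ∀ l : List (ℕ × G), (∀ z ∈ l, z ∈ V) →
      ∃ m : ℕ, m * ((R : ℝ) ^ n)⁻¹ ≤ cost R l ∧ ∀ e : ℤ,
        |(e : ℝ)| * ((R : ℝ) ^ n)⁻¹ + cost R l ≤ A →
          Rep (V \ {(n, x)}) R ((C + 1) * cost R l)
            (x ^ e * (l.map Prod.snd).prod * x ^ (-(e + m))) := by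
  obtain ⟨C, hC, H⟩ := exists_rep_commutator_letter hc A hA
  have hsub : comms S (n + 1) ⊆ V \ {(n, x)} := by
    refine fun y hy => ⟨hup y hy.1 hy.2, ?_⟩
    rintro rfl
    exact absurd hy.2 (by simp)
  refine ⟨C, hC, fun R hR l => ?_⟩
  induction l with
  | nil =>
    refine fun _ => ⟨0, by simp, fun e _ => ?_⟩
    simpa using Rep.one le_rfl
  | cons z l ih =>
    intro hl
    obtain ⟨m, hm, ih⟩ := ih fun z hz => hl z (by simp [hz])
    have hz := hl z (by simp)
    by_cases hzx : z = (n, x)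
    · subst hzx
      refine ⟨m + 1, ?_, fun e he => ?_⟩
      · rw [cost_cons]
        push_cast
        linarith
      · rw [cost_cons] at he ⊢
        have h0 : (0 : ℝ) ≤ ((R : ℝ) ^ n)⁻¹ := by positivity
        have h1 : |((e + 1 : ℤ) : ℝ)| ≤ |(e : ℝ)| + 1 := by
          push_cast
          simpa using abs_add_le (e : ℝ) 1
        have h2 := ih (e + 1) (by
          have := mul_le_mul_of_nonneg_right h1 h0
          simp only at he
          linarith)
        convert h2.mono le_rfl ?_ using 1
        · simp only [List.map_cons, List.prod_cons]
          push_cast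
          group
        · have : 0 ≤ (C + 1) * ((R : ℝ) ^ n)⁻¹ := by positivity
          simp only
          linarith
    · refine ⟨m, hm.trans ?_, fun e he => ?_⟩
      · rw [cost_cons]
        have : (0 : ℝ) ≤ ((R : ℝ) ^ z.1)⁻¹ := by positivity
        linarith
      · rw [cost_cons] at he ⊢
        have h0 : (0 : ℝ) ≤ ((R : ℝ) ^ z.1)⁻¹ := by positivity
        have h2 := ih e (by linarith)
        have hle : |(e : ℝ)| * ((R : ℝ) ^ n)⁻¹ ≤ A := by
          have := cost_nonneg R l
          linarith
        have h3 := H R n _ (((hV _ hx).rep_zpow hS R e).mono le_rfl hle) _ _ (hV z hz)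
        have hpos := (hV z hz).pos
        have h4 : Rep (V \ {(n, x)}) R ((R : ℝ) ^ z.1)⁻¹ z.2 := Rep.letter ⟨hz, hzx⟩
        convert ((h3.mono ((comms_anti (by omega : n + 1 ≤ n + z.1)).trans hsub) le_rfl).mul
          h4).mul h2 using 1
        · ring
        · simp only [List.map_cons, List.prod_cons, commutatorElement_def]
          group

/-- All powers `z ^ b` with `b ≤ Rⁿ` have word length `O(R)`. -/
def HasShortPowers (S : Finset G) (n : ℕ) (z : G) : Prop :=
  ∃ C : ℕ, ∀ R : ℕ, 1 ≤ R → ∀ b ≤ R ^ n, wordLength S (z ^ b) ≤ C * R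

include hc hS in
theorem exists_cover (F : Finset (ℕ × G)) : ∀ V : Set (ℕ × G), (∀ z ∈ V, IsComm S z.1 z.2) →
    (∀ z ∈ V, ∀ y : ℕ × G, IsComm S y.1 y.2 → z.1 < y.1 → y ∈ V) →
    (∀ z ∈ V, z.1 ≤ c → z ∈ F) → (∀ z ∈ V, HasShortPowers S z.1 z.2) →
    ∃ M : ℕ, ∀ A : ℕ, ∃ K : ℕ, ∀ R : ℕ, 1 ≤ R → ∃ T : Finset G, T.card ≤ K ∧
      (∀ f ∈ T, wordLength S f ≤ K * R) ∧
      ∀ g, Rep V R A g → ∃ f ∈ T, wordLength S (f⁻¹ * g) ≤ M * R := by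
  classical
  induction F using Finset.strongInduction with
  | H F ih =>
    intro V hV hup hF hlen
    by_cases hne : ∃ z ∈ V, z.1 ≤ c
    · obtain ⟨w, hwV, hwc⟩ := hne
      obtain ⟨⟨n, x⟩, hx, hmin'⟩ := (measure (Prod.fst : ℕ × G → ℕ)).wf.has_min V ⟨w, hwV⟩
      have hmin : ∀ y ∈ V, n ≤ y.1 := fun y hy => not_lt.mp (hmin' y hy)
      obtain ⟨Cx, hCx⟩ := hlen _ hx
      obtain ⟨M, HM⟩ := ih (F.erase (n, x))
        (Finset.erase_ssubset (hF _ hx ((hmin w hwV).trans hwc))) (V \ {(n, x)})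
        (fun z hz => hV z hz.1)
        (fun z hz y hy hzy => ⟨hup z hz.1 y hy hzy, by
          rintro rfl
          exact absurd (hmin z hz.1) (not_le.mpr hzy)⟩)
        (fun z hz hzc => Finset.mem_erase.mpr ⟨hz.2, hF z hz.1 hzc⟩)
        (fun z hz => hlen z hz.1)
      refine ⟨M + Cx, fun A => ?_⟩
      obtain ⟨C, hC, HC⟩ := exists_rep_extract hc hS hV hx (fun y hy h => hup _ hx y hy h)
        (2 * A) (by positivity)
      obtain ⟨K, HK⟩ := HM ⌈(C + 1) * A⌉₊
      refine ⟨(A + 1) * K + A * Cx + K, fun R hR => ?_⟩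
      obtain ⟨T, hTc, hTl, hT⟩ := HK R hR
      have hRn : 0 < R ^ n := by positivity
      refine ⟨(Finset.range (A + 1) ×ˢ T).image fun p => (x ^ R ^ n) ^ p.1 * p.2, ?_, ?_, ?_⟩
      · refine Finset.card_image_le.trans ?_
        rw [Finset.card_product, Finset.card_range]
        have := Nat.mul_le_mul_left (A + 1) hTc
        omega
      · intro f hf
        obtain ⟨⟨q, f'⟩, hq, rfl⟩ := Finset.mem_image.mp hf
        obtain ⟨hq, hf'⟩ := Finset.mem_product.mp hq
        have h1 : q ≤ A := by simpa [Nat.lt_succ_iff] using hq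
        calc wordLength S ((x ^ R ^ n) ^ q * f')
            ≤ wordLength S ((x ^ R ^ n) ^ q) + wordLength S f' := hS.wordLength_mul_le _ _
          _ ≤ q * wordLength S (x ^ R ^ n) + wordLength S f' := by
            gcongr
            exact hS.wordLength_pow_le _ _
          _ ≤ A * (Cx * R) + K * R := by
            gcongr
            · exact hCx R hR _ le_rfl
            · exact hTl _ hf'
          _ ≤ ((A + 1) * K + A * Cx + K) * R := by
            rw [← mul_assoc, ← add_mul]
            exact Nat.mul_le_mul_right _ (by rw [add_assoc]; exact Nat.le_add_left _ _)
      · rintro g ⟨l, hl, rfl, hlA⟩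
        obtain ⟨m, hm, H⟩ := HC R hR l hl
        have hmA : m ≤ A * R ^ n := by
          have h1 := hm.trans hlA
          rw [← div_eq_mul_inv, div_le_iff₀ (by positivity)] at h1
          exact_mod_cast h1
        set q := m / R ^ n with hq
        have hqm : R ^ n * q ≤ m := Nat.mul_div_le _ _
        have hrep := H (-(R ^ n * q : ℕ)) (by
          have h1 : ((R ^ n * q : ℕ) : ℝ) * ((R : ℝ) ^ n)⁻¹ ≤ m * ((R : ℝ) ^ n)⁻¹ := by
            gcongr
          rw [Int.cast_neg, abs_neg, Int.cast_natCast, Nat.abs_cast]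
          linarith)
        obtain ⟨f, hf, hfl⟩ := hT _ (hrep.mono le_rfl
          ((mul_le_mul_of_nonneg_left hlA (by positivity)).trans (Nat.le_ceil _)))
        refine ⟨(x ^ R ^ n) ^ q * f, Finset.mem_image.mpr ⟨(q, f), Finset.mem_product.mpr
          ⟨Finset.mem_range.mpr (Nat.lt_succ_of_le (Nat.div_le_of_le_mul (by rwa [mul_comm]))),
            hf⟩, rfl⟩, ?_⟩
        have hb : wordLength S (x ^ (m % R ^ n)) ≤ Cx * R := hCx R hR _ (Nat.mod_lt _ hRn).le
        have hdm : m = R ^ n * q + m % R ^ n := (Nat.div_add_mod m (R ^ n)).symm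
        set b := m % R ^ n
        have hmul := hS.wordLength_mul_le (f⁻¹ * (x ^ (-((R ^ n * q : ℕ) : ℤ)) *
          (l.map Prod.snd).prod * x ^ (-(-((R ^ n * q : ℕ) : ℤ) + m)))) (x ^ b)
        have heq : ((x ^ R ^ n) ^ q * f)⁻¹ * (l.map Prod.snd).prod =
            f⁻¹ * (x ^ (-((R ^ n * q : ℕ) : ℤ)) *
              (l.map Prod.snd).prod * x ^ (-(-((R ^ n * q : ℕ) : ℤ) + m))) * x ^ b := by
          rw [show -(-((R ^ n * q : ℕ) : ℤ) + m) = -(b : ℤ) by rw [hdm]; push_cast; ring,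
            ← pow_mul, zpow_neg, zpow_neg, zpow_natCast, zpow_natCast]
          group
        rw [heq, add_mul]
        exact hmul.trans (add_le_add hfl hb)
    · push Not at hne
      refine ⟨0, fun A => ⟨1, fun R hR => ⟨{1}, by simp, by simp [wordLength_one], ?_⟩⟩⟩
      rintro g ⟨l, hl, rfl, -⟩
      refine ⟨1, by simp, ?_⟩
      rw [List.prod_eq_one]
      · simp [wordLength_one]
      · intro y hy
        obtain ⟨z, hz, rfl⟩ := List.mem_map.mp hy
        exact hc _ _ (hV z (hl z hz)) (hne z (hl z hz))

theorem finite_comms_le (S : Finset G) (c : ℕ) :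
    {z : ℕ × G | IsComm S z.1 z.2 ∧ z.1 ≤ c}.Finite := by
  refine ((Set.finite_Iic c).biUnion fun n _ =>
    (finite_isComm S n).image fun g => (n, g)).subset fun z hz => ?_
  exact Set.mem_biUnion (x := z.1) hz.2 ⟨z.2, hz.1, rfl⟩

include hc hS in
theorem exists_cover_comms (k : ℕ) (hk : ∀ n z, IsComm S n z → k ≤ n → HasShortPowers S n z) :
    ∃ M : ℕ, ∀ A : ℕ, ∃ K : ℕ, ∀ R : ℕ, 1 ≤ R → ∃ T : Finset G, T.card ≤ K ∧
      (∀ f ∈ T, wordLength S f ≤ K * R) ∧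
      ∀ g, Rep (comms S k) R A g → ∃ f ∈ T, wordLength S (f⁻¹ * g) ≤ M * R :=
  exists_cover hc hS (finite_comms_le S c).toFinset (comms S k) (fun _ hz => hz.1)
    (fun _ hz _ hy hzy => ⟨hy, hz.2.trans hzy.le⟩)
    (fun z hz hzc => by simpa using ⟨hz.1, hzc⟩) (fun z hz => hk _ _ hz.1 hz.2)

include hc hS in
theorem IsComm.hasShortPowers {n : ℕ} {z : G} (hz : IsComm S n z) : HasShortPowers S n z := by
  suffices H : ∀ d, ∀ n z, IsComm S n z → c < n + d → HasShortPowers S n z from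
    H (c + 1) n z hz (by omega)
  intro d
  induction d with
  | zero =>
    intro n z hz hn
    refine ⟨0, fun R _ b _ => ?_⟩
    rw [hc n z hz hn, one_pow, wordLength_one]
    exact Nat.zero_le _
  | succ d ih =>
    intro n z hz hn
    obtain ⟨M, HM⟩ := exists_cover_comms hc hS (n + 1) fun i y hy hi => ih i y hy (by omega)
    obtain ⟨C, A, hA, HA⟩ := hz.exists_short_approx hc hS
    obtain ⟨K, HK⟩ := HM ⌈A⌉₊
    refine ⟨M + K + C, fun R hR b hb => ?_⟩
    obtain ⟨T, -, hTl, hT⟩ := HK R hR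
    obtain ⟨h, hh, hrep⟩ := HA R hR b hb
    obtain ⟨f, hf, hfl⟩ := hT _ (hrep.mono le_rfl (Nat.le_ceil A))
    have h1 := hS.wordLength_mul_le ((f⁻¹ * (h * (z ^ b)⁻¹))⁻¹ * f⁻¹) h
    have h2 := hS.wordLength_mul_le (f⁻¹ * (h * (z ^ b)⁻¹))⁻¹ f⁻¹
    rw [hS.wordLength_inv, hS.wordLength_inv] at h2
    have h3 := hTl f hf
    have heq : (f⁻¹ * (h * (z ^ b)⁻¹))⁻¹ * f⁻¹ * h = z ^ b := by group
    rw [heq] at h1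
    rw [add_mul, add_mul]
    omega

end Covering

section Doubling

variable {S : Finset G}

/-- The number of elements of word length at most `r`. -/
noncomputable def ballCard (S : Finset G) (r : ℕ) : ℕ := {g : G | wordLength S g ≤ r}.ncard

theorem IsSymmGen.ballCard_mono (hS : IsSymmGen S) {r r' : ℕ} (h : r ≤ r') :
    ballCard S r ≤ ballCard S r' :=
  Set.ncard_le_ncard (fun _ hg => le_trans hg h) (hS.finite_ball r')

theorem IsSymmGen.ballCard_pos (hS : IsSymmGen S) (r : ℕ) : 0 < ballCard S r :=
  (Set.ncard_pos (hS.finite_ball r)).mpr ⟨1, by simp [wordLength_one]⟩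

theorem IsSymmGen.rep_comms (hS : IsSymmGen S) {R A : ℕ} (hR : 1 ≤ R) {g : G}
    (hg : wordLength S g ≤ A * R) : Rep (comms S 1) R A g := by
  obtain ⟨l, hl, hlS, rfl⟩ := hS.exists_list_length_eq g
  refine ⟨l.map fun s => (1, s), ?_, ?_, ?_⟩
  · intro z hz
    obtain ⟨s, hs, rfl⟩ := List.mem_map.mp hz
    exact ⟨.of (hlS s hs), le_rfl⟩
  · simp [Function.comp_def]
  · have h1 : (l.length : ℝ) ≤ A * R := by exact_mod_cast hl ▸ hg
    have h2 : (0 : ℝ) < R := by exact_mod_cast hR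
    simpa [cost, Function.comp_def, ← div_eq_mul_inv, div_le_iff₀ h2] using h1

theorem IsSymmGen.exists_doubling (hS : IsSymmGen S) (hG : Group.IsNilpotent G) (A : ℕ) :
    ∃ K : ℕ, ∀ r, ballCard S (A * (r + 1)) ≤ K * ballCard S r := by
  classical
  obtain ⟨c, hc⟩ := exists_isComm_eq_one S hG
  obtain ⟨M, HM⟩ := exists_cover_comms hc hS 1 fun n z hz _ => hz.hasShortPowers hc hS
  obtain ⟨K, HK⟩ := HM (2 * A * (M + 1))
  refine ⟨max K (ballCard S (A * (M + 1))), fun r => ?_⟩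
  by_cases hr : r < M + 1
  · calc ballCard S (A * (r + 1)) ≤ ballCard S (A * (M + 1)) :=
        hS.ballCard_mono (Nat.mul_le_mul_left _ (by omega))
      _ = ballCard S (A * (M + 1)) * 1 := (mul_one _).symm
      _ ≤ _ := Nat.mul_le_mul (le_max_right _ _) (hS.ballCard_pos r)
  · push Not at hr
    set R := r / (M + 1) with hRdef
    have hR : 1 ≤ R := (Nat.one_le_div_iff (by omega)).mpr hr
    have hMR : (M + 1) * R ≤ r := Nat.mul_div_le _ _
    have hrR : r + 1 ≤ (M + 1) * (R + 1) := Nat.lt_mul_div_succ r (by omega)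
    have hAr : A * (r + 1) ≤ 2 * A * (M + 1) * R := calc
      A * (r + 1) ≤ A * ((M + 1) * (2 * R)) := by
        refine Nat.mul_le_mul_left _ (hrR.trans ?_)
        gcongr
        omega
      _ = 2 * A * (M + 1) * R := by ring
    obtain ⟨T, hTc, -, hT⟩ := HK R hR
    have hsub : {g : G | wordLength S g ≤ A * (r + 1)} ⊆
        ⋃ f ∈ T, (fun g => f * g) '' {g : G | wordLength S g ≤ r} := by
      intro g hg
      obtain ⟨f, hf, hfl⟩ := hT g (hS.rep_comms hR (le_trans hg hAr))
      refine Set.mem_biUnion hf ⟨f⁻¹ * g, hfl.trans (le_trans ?_ hMR), by group⟩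
      gcongr
      omega
    calc ballCard S (A * (r + 1))
        ≤ (⋃ f ∈ T, (fun g => f * g) '' {g : G | wordLength S g ≤ r}).ncard :=
          Set.ncard_le_ncard hsub (T.finite_toSet.biUnion fun f _ => (hS.finite_ball r).image _)
      _ ≤ ∑ f ∈ T, ((fun g => f * g) '' {g : G | wordLength S g ≤ r}).ncard :=
          Finset.set_ncard_biUnion_le _ _
      _ ≤ ∑ _f ∈ T, ballCard S r :=
          Finset.sum_le_sum fun f _ => Set.ncard_image_le (hS.finite_ball r)
      _ = T.card * ballCard S r := by simp
      _ ≤ _ := Nat.mul_le_mul_right _ (hTc.trans (le_max_left _ _))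

/-- The number of elements `g` whose word length satisfies `|g|² ≤ k`. -/
noncomputable def sqBall (S : Finset G) (k : ℕ) : ℕ := ballCard S (Nat.sqrt k)

theorem IsSymmGen.exists_sqBall_doubling (hS : IsSymmGen S) (hG : Group.IsNilpotent G) (A : ℕ) :
    ∃ K : ℕ, ∀ k, sqBall S (A * (k + 1)) ≤ K * sqBall S k := by
  obtain ⟨K, hK⟩ := hS.exists_doubling hG A
  refine ⟨K, fun k => (hS.ballCard_mono ?_).trans (hK (Nat.sqrt k))⟩
  have h1 := Nat.succ_le_succ_sqrt' k
  calc Nat.sqrt (A * (k + 1)) ≤ Nat.sqrt ((A * (Nat.sqrt k + 1)) ^ 2) := by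
        refine Nat.sqrt_le_sqrt ?_
        rw [mul_pow]
        exact Nat.mul_le_mul (Nat.le_self_pow two_ne_zero A) h1
    _ = A * (Nat.sqrt k + 1) := Nat.sqrt_eq' _

theorem IsSymmGen.sqBall_mono (hS : IsSymmGen S) {k k' : ℕ} (h : k ≤ k') :
    sqBall S k ≤ sqBall S k' :=
  hS.ballCard_mono (Nat.sqrt_le_sqrt h)

theorem IsSymmGen.sqBall_pos (hS : IsSymmGen S) (k : ℕ) : 0 < sqBall S k :=
  hS.ballCard_pos _

end Doubling

end NilpotentGrowth

section Averaging

variable {S : Finset G}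

/-- The number of lazy letters. -/
def numLetters (S : Finset G) : ℝ := S.card + 1

omit [Group G] in
theorem one_le_numLetters (S : Finset G) : 1 ≤ numLetters S := by
  simp [numLetters]

omit [Group G] in
theorem numLetters_pos (S : Finset G) : 0 < numLetters S :=
  zero_lt_one.trans_le (one_le_numLetters S)

omit [Group G] in
theorem card_letters (S : Finset G) : (Fintype.card (Option {x // x ∈ S}) : ℝ) = numLetters S := by
  simp [numLetters]

omit [Group G] in
theorem sum_letters_const (S : Finset G) (r : ℝ) :
    ∑ _a : Option {x // x ∈ S}, r = numLetters S * r := by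
  rw [Finset.sum_const, Finset.card_univ, nsmul_eq_mul, card_letters]

theorem IsSymmGen.sum_letters_inv (hS : IsSymmGen S) (f : G → ℝ) :
    ∑ a : Option {x // x ∈ S}, f (lazyVal a)⁻¹ = ∑ a : Option {x // x ∈ S}, f (lazyVal a) := by
  let e : {x // x ∈ S} ≃ {x // x ∈ S} :=
    { toFun := fun s => ⟨s.1⁻¹, hS.inv_mem _ s.2⟩
      invFun := fun s => ⟨s.1⁻¹, hS.inv_mem _ s.2⟩
      left_inv := fun s => by simp
      right_inv := fun s => by simp }
  refine Fintype.sum_equiv (Equiv.optionCongr e) _ _ fun a => ?_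
  cases a <;> simp [lazyVal, e]

theorem wordLength_lazyVal_le (a : Option {x // x ∈ S}) : wordLength S (lazyVal a) ≤ 1 := by
  cases a with
  | none => simp [lazyVal, wordLength_one]
  | some s => exact wordLength_le_one s.2

/-- The Markov operator of the lazy simple random walk. -/
noncomputable def avg (S : Finset G) (f : G → ℝ) (x : G) : ℝ :=
  (∑ a : Option {x // x ∈ S}, f (x * lazyVal a)) / numLetters S

theorem avg_nonneg {f : G → ℝ} (hf : ∀ x, 0 ≤ f x) (x : G) : 0 ≤ avg S f x :=
  div_nonneg (Finset.sum_nonneg fun _ _ => hf _) (numLetters_pos S).le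

theorem avg_le {f : G → ℝ} {M : ℝ} (hf : ∀ x, f x ≤ M) (x : G) : avg S f x ≤ M := by
  rw [avg, div_le_iff₀ (numLetters_pos S), mul_comm, ← sum_letters_const]
  exact Finset.sum_le_sum fun _ _ => hf _

theorem le_avg {f : G → ℝ} (hf : ∀ x, 0 ≤ f x) (x : G) (a : Option {x // x ∈ S}) :
    f (x * lazyVal a) ≤ numLetters S * avg S f x := by
  rw [avg, mul_div_cancel₀ _ (numLetters_pos S).ne']
  exact Finset.single_le_sum (f := fun a => f (x * lazyVal a)) (fun _ _ => hf _)
    (Finset.mem_univ a)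

open scoped Classical in
/-- The distribution after `n` steps of the lazy simple random walk started at `1`. -/
noncomputable def walkProb (S : Finset G) (n : ℕ) : G → ℝ :=
  (avg S)^[n] fun x => if x = 1 then 1 else 0

theorem walkProb_succ (n : ℕ) : walkProb S (n + 1) = avg S (walkProb S n) :=
  Function.iterate_succ_apply' _ _ _

open scoped Classical in
theorem walkProb_zero (x : G) : walkProb S 0 x = if x = 1 then 1 else 0 := rfl

theorem walkProb_nonneg (n : ℕ) : ∀ x, 0 ≤ walkProb S n x := by
  induction n with
  | zero => intro x; rw [walkProb_zero]; split_ifs <;> norm_num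
  | succ n ih => intro x; rw [walkProb_succ]; exact avg_nonneg ih x

theorem IsSymmGen.wordLength_le_of_walkProb_ne_zero (hS : IsSymmGen S) {n : ℕ} :
    ∀ {x : G}, walkProb S n x ≠ 0 → wordLength S x ≤ n := by
  induction n with
  | zero =>
    intro x hx
    rw [walkProb_zero] at hx
    have : x = 1 := by by_contra h; simp [h] at hx
    simp [this, wordLength_one]
  | succ n ih =>
    intro x hx
    rw [walkProb_succ, avg] at hx
    obtain ⟨a, -, ha⟩ := Finset.exists_ne_zero_of_sum_ne_zero (div_ne_zero_iff.mp hx).1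
    have h1 := ih ha
    have h2 := hS.wordLength_mul_le (x * lazyVal a) (lazyVal a)⁻¹
    rw [hS.wordLength_inv, mul_inv_cancel_right] at h2
    have h3 := wordLength_lazyVal_le a
    omega

theorem IsSymmGen.finite_support_walkProb (hS : IsSymmGen S) (n : ℕ) :
    (walkProb S n).support.Finite :=
  (hS.finite_ball n).subset fun _ hx => hS.wordLength_le_of_walkProb_ne_zero hx

end Averaging

section FiniteSupport

theorem summable_of_support {ι : Type*} {f g : ι → ℝ} (hf : f.support.Finite)
    (h : ∀ x, f x = 0 → g x = 0) : Summable g :=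
  summable_of_hasFiniteSupport (hf.subset fun x hx hfx => hx (h x hfx))

theorem finite_support_comp_mul_right {f : G → ℝ} (hf : f.support.Finite) (a : G) :
    (fun x => f (x * a)).support.Finite :=
  hf.preimage (mul_left_injective a).injOn

theorem finite_support_comp_mul_left {f : G → ℝ} (hf : f.support.Finite) (a : G) :
    (fun x => f (a * x)).support.Finite :=
  hf.preimage (mul_right_injective a).injOn

theorem tsum_mul_right_shift (f : G → ℝ) (a : G) : ∑' x, f (x * a) = ∑' x, f x :=
  (Equiv.mulRight a).tsum_eq f

theorem tsum_mul_left_shift (f : G → ℝ) (a : G) : ∑' x, f (a * x) = ∑' x, f x :=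
  (Equiv.mulLeft a).tsum_eq f

variable {S : Finset G} (hS : IsSymmGen S)
include hS

theorem IsSymmGen.tsum_avg_mul {f : G → ℝ} (hf : f.support.Finite) (g : G → ℝ) :
    ∑' x, avg S f x * g x = ∑' x, f x * avg S g x := by
  have h1 : ∀ a : Option {x // x ∈ S}, Summable fun x => f (x * lazyVal a) * g x := fun a =>
    summable_of_support (finite_support_comp_mul_right hf (lazyVal a)) fun x hx => by simp [hx]
  have h2 : ∀ a : Option {x // x ∈ S}, Summable fun x => f x * g (x * lazyVal a) := fun a =>
    summable_of_support hf fun x hx => by simp [hx]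
  have e1 : ∀ x, avg S f x * g x =
      (∑ a : Option {x // x ∈ S}, f (x * lazyVal a) * g x) / numLetters S := fun x => by
    rw [avg, div_mul_eq_mul_div, Finset.sum_mul]
  have e2 : ∀ x, f x * avg S g x =
      (∑ a : Option {x // x ∈ S}, f x * g (x * lazyVal a)) / numLetters S := fun x => by
    rw [avg, mul_div_assoc', Finset.mul_sum]
  simp_rw [e1, e2, tsum_div_const]
  rw [Summable.tsum_finsetSum fun a _ => h1 a, Summable.tsum_finsetSum fun a _ => h2 a,
    ← hS.sum_letters_inv fun a => ∑' x, f x * g (x * a)]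
  congr 1
  refine Finset.sum_congr rfl fun a _ => ?_
  rw [← tsum_mul_right_shift (fun x => f x * g (x * (lazyVal a)⁻¹)) (lazyVal a)]
  simp

theorem IsSymmGen.tsum_walkProb_mul_walkProb (y : G) (k n : ℕ) :
    ∑' x, walkProb S k (y⁻¹ * x) * walkProb S n x = walkProb S (k + n) y := by
  classical
  induction k generalizing n with
  | zero =>
    rw [tsum_eq_single y, zero_add]
    · simp [walkProb_zero]
    · intro x hx
      rw [walkProb_zero, if_neg, zero_mul]
      rwa [inv_mul_eq_one, eq_comm]
  | succ k ih =>
    have h1 : ∀ x, walkProb S (k + 1) (y⁻¹ * x) = avg S (fun z => walkProb S k (y⁻¹ * z)) x := by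
      intro x
      simp only [walkProb_succ, avg, mul_assoc]
    simp_rw [h1]
    rw [hS.tsum_avg_mul (finite_support_comp_mul_left (hS.finite_support_walkProb k) y⁻¹),
      ← walkProb_succ, ih]
    congr 1
    omega

theorem IsSymmGen.tsum_mul_walkProb (f : G → ℝ) (n : ℕ) :
    ∑' x, f x * walkProb S n x = (avg S)^[n] f 1 := by
  classical
  induction n generalizing f with
  | zero =>
    rw [tsum_eq_single 1]
    · simp [walkProb_zero]
    · intro x hx
      simp [walkProb_zero, hx]
  | succ n ih =>
    rw [Function.iterate_succ_apply, ← ih]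
    simp_rw [mul_comm _ (walkProb S _ _)]
    rw [← hS.tsum_avg_mul (hS.finite_support_walkProb n), ← walkProb_succ]

theorem IsSymmGen.tsum_walkProb (n : ℕ) : ∑' x, walkProb S n x = 1 := by
  have h := hS.tsum_mul_walkProb (fun _ => 1) n
  simp only [one_mul] at h
  rw [h]
  have hfix : avg S (fun _ => 1) = fun _ => 1 := by
    ext x
    rw [avg, sum_letters_const, mul_one, div_self (numLetters_pos S).ne']
  rw [Function.iterate_fixed hfix]

theorem IsSymmGen.tsum_walkProb_sq (n : ℕ) :
    ∑' x, walkProb S n x ^ 2 = walkProb S (2 * n) 1 := by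
  rw [two_mul, ← hS.tsum_walkProb_mul_walkProb]
  simp [sq]

end FiniteSupport

section ReturnProbability

variable {S : Finset G} (hS : IsSymmGen S)

omit [Group G] in
theorem summable_sub_sq {f g : G → ℝ} (hf : f.support.Finite) (hg : g.support.Finite) :
    Summable fun x => (f x - g x) ^ 2 :=
  summable_of_hasFiniteSupport ((hf.union hg).subset fun x hx => by
    by_contra h
    rw [Set.mem_union, not_or, Function.notMem_support, Function.notMem_support] at h
    simp [h.1, h.2] at hx)

theorem avg_const_sub (r : ℝ) (f : G → ℝ) (x : G) :
    avg S (fun y => r - f y) x = r - avg S f x := by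
  rw [avg, avg, Finset.sum_sub_distrib, sum_letters_const, sub_div,
    mul_div_cancel_left₀ _ (numLetters_pos S).ne']

section
include hS

theorem IsSymmGen.tsum_walkProb_sub_sq (k : ℕ) (y : G) :
    ∑' x, (walkProb S k x - walkProb S k (y⁻¹ * x)) ^ 2 =
      2 * (walkProb S (2 * k) 1 - walkProb S (2 * k) y) := by
  have hf := hS.finite_support_walkProb k
  have h1 : Summable fun x => walkProb S k x ^ 2 :=
    summable_of_support hf fun x hx => by simp [hx]
  have h2 : Summable fun x => 2 * (walkProb S k (y⁻¹ * x) * walkProb S k x) :=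
    summable_of_support hf fun x hx => by simp [hx]
  have h3 : Summable fun x => walkProb S k (y⁻¹ * x) ^ 2 :=
    summable_of_support (finite_support_comp_mul_left hf y⁻¹) fun x hx => by simp [hx]
  have e : ∀ x, (walkProb S k x - walkProb S k (y⁻¹ * x)) ^ 2 = walkProb S k x ^ 2 -
      2 * (walkProb S k (y⁻¹ * x) * walkProb S k x) + walkProb S k (y⁻¹ * x) ^ 2 :=
    fun x => by ring
  simp_rw [e]
  rw [(h1.sub h2).tsum_add h3, h1.tsum_sub h2, tsum_mul_left, hS.tsum_walkProb_mul_walkProb,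
    tsum_mul_left_shift (fun x => walkProb S k x ^ 2), hS.tsum_walkProb_sq, two_mul k]
  ring

theorem IsSymmGen.walkProb_even_le (k : ℕ) (y : G) :
    walkProb S (2 * k) y ≤ walkProb S (2 * k) 1 := by
  have h := hS.tsum_walkProb_sub_sq k y
  have h0 : 0 ≤ ∑' x, (walkProb S k x - walkProb S k (y⁻¹ * x)) ^ 2 :=
    tsum_nonneg fun x => sq_nonneg _
  linarith

theorem IsSymmGen.walkProb_le (n : ℕ) (y : G) :
    walkProb S n y ≤ walkProb S (2 * (n / 2)) 1 := by
  rcases Nat.even_or_odd' n with ⟨k, rfl | rfl⟩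
  · rw [Nat.mul_div_cancel_left _ two_pos]
    exact hS.walkProb_even_le k y
  · rw [show (2 * k + 1) / 2 = k by omega, walkProb_succ]
    exact avg_le (hS.walkProb_even_le k) y

theorem IsSymmGen.antitone_return : Antitone fun k => walkProb S (2 * k) 1 :=
  antitone_nat_of_succ_le fun k => by
    rw [show 2 * (k + 1) = 2 * k + 1 + 1 by ring, walkProb_succ, walkProb_succ]
    exact avg_le (fun x => avg_le (hS.walkProb_even_le k) x) 1

theorem IsSymmGen.return_convex (k : ℕ) :
    walkProb S (2 * (k + 1)) 1 - walkProb S (2 * (k + 2)) 1 ≤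
      walkProb S (2 * k) 1 - walkProb S (2 * (k + 1)) 1 := by
  have hf := hS.finite_support_walkProb k
  have h1 : Summable fun x => walkProb S k x ^ 2 :=
    summable_of_support hf fun x hx => by simp [hx]
  have h2 : Summable fun x => 2 * (walkProb S k x * walkProb S (k + 2) x) :=
    summable_of_support hf fun x hx => by simp [hx]
  have h3 : Summable fun x => walkProb S (k + 2) x ^ 2 :=
    summable_of_support (hS.finite_support_walkProb (k + 2)) fun x hx => by simp [hx]
  have e : ∀ x, (walkProb S k x - walkProb S (k + 2) x) ^ 2 = walkProb S k x ^ 2 -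
      2 * (walkProb S k x * walkProb S (k + 2) x) + walkProb S (k + 2) x ^ 2 :=
    fun x => by ring
  have h0 : 0 ≤ ∑' x, (walkProb S k x - walkProb S (k + 2) x) ^ 2 :=
    tsum_nonneg fun x => sq_nonneg _
  have hin : ∑' x, walkProb S k x * walkProb S (k + 2) x = walkProb S (2 * (k + 1)) 1 := by
    rw [show 2 * (k + 1) = k + (k + 2) by ring, ← hS.tsum_walkProb_mul_walkProb]
    simp
  simp_rw [e] at h0
  rw [(h1.sub h2).tsum_add h3, h1.tsum_sub h2, tsum_mul_left, hin, hS.tsum_walkProb_sq,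
    hS.tsum_walkProb_sq] at h0
  linarith

theorem IsSymmGen.mul_return_sub_le (j i : ℕ) :
    (i + 1) * (walkProb S (2 * (j + i)) 1 - walkProb S (2 * (j + i + 1)) 1) ≤
      walkProb S (2 * j) 1 := by
  suffices H : (i + 1) * (walkProb S (2 * (j + i)) 1 - walkProb S (2 * (j + i + 1)) 1) ≤
      walkProb S (2 * j) 1 - walkProb S (2 * (j + i + 1)) 1 by
    have := walkProb_nonneg (S := S) (2 * (j + i + 1)) 1
    linarith
  induction i with
  | zero => simp
  | succ i ih =>
    have h := mul_le_mul_of_nonneg_left (hS.return_convex (j + i))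
      (by positivity : (0 : ℝ) ≤ i + 1)
    rw [← add_assoc]
    push_cast
    rw [show j + i + 2 = j + i + 1 + 1 by ring] at h
    linarith

theorem IsSymmGen.return_sub_letter_le (k : ℕ) (a : Option {x // x ∈ S}) :
    walkProb S (2 * k) 1 - walkProb S (2 * k) (lazyVal a) ≤
      numLetters S ^ 2 * (walkProb S (2 * k) 1 - walkProb S (2 * (k + 1)) 1) := by
  have h0 : ∀ x, 0 ≤ walkProb S (2 * k) 1 - walkProb S (2 * k) x := fun x =>
    sub_nonneg.mpr (hS.walkProb_even_le k x)
  have h1 := le_avg h0 1 a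
  have h2 := le_avg (avg_nonneg (S := S) h0) 1 (none : Option {x // x ∈ S})
  rw [one_mul] at h1
  rw [show (lazyVal (none : Option {x // x ∈ S}) : G) = 1 from rfl, one_mul] at h2
  have h3 : avg S (avg S fun x => walkProb S (2 * k) 1 - walkProb S (2 * k) x) 1 =
      walkProb S (2 * k) 1 - walkProb S (2 * (k + 1)) 1 := by
    rw [show (avg S fun x => walkProb S (2 * k) 1 - walkProb S (2 * k) x) =
      fun x => walkProb S (2 * k) 1 - avg S (walkProb S (2 * k)) x from
        funext fun x => avg_const_sub _ _ x, avg_const_sub, ← walkProb_succ, ← walkProb_succ]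
    rfl
  rw [h3] at h2
  calc _ ≤ _ := h1
    _ ≤ numLetters S * _ := mul_le_mul_of_nonneg_left h2 (numLetters_pos S).le
    _ = _ := by ring

theorem IsSymmGen.return_sub_le (k : ℕ) (y : G) :
    walkProb S (2 * k) 1 - walkProb S (2 * k) y ≤ wordLength S y ^ 2 *
      (numLetters S ^ 2 * (walkProb S (2 * k) 1 - walkProb S (2 * (k + 1)) 1)) := by
  obtain ⟨l, hl, hlS, rfl⟩ := hS.exists_list_length_eq y
  rw [← hl]
  clear hl
  set D := numLetters S ^ 2 * (walkProb S (2 * k) 1 - walkProb S (2 * (k + 1)) 1) with hD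
  induction l with
  | nil => simp
  | cons s l ih =>
    have ih := ih fun x hx => hlS x (by simp [hx])
    have hs : walkProb S (2 * k) 1 - walkProb S (2 * k) s ≤ D :=
      hS.return_sub_letter_le k (some ⟨s, hlS s (by simp)⟩)
    rw [List.prod_cons, List.length_cons]
    set y := l.prod
    rcases Nat.eq_zero_or_pos l.length with h0 | hpos
    · have hy : y = 1 := by simp [y, List.length_eq_zero_iff.mp h0]
      rw [h0, hy]
      simpa using hs
    have hr : (0 : ℝ) < l.length := by exact_mod_cast hpos
    set r : ℝ := (l.length : ℝ) with hr_def
    have hf := hS.finite_support_walkProb k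
    have n1 := hS.tsum_walkProb_sub_sq k s
    have n2 := hS.tsum_walkProb_sub_sq k y
    have n3 := hS.tsum_walkProb_sub_sq k (s * y)
    rw [← tsum_mul_left_shift _ s⁻¹] at n2
    have hf1 := finite_support_comp_mul_left hf s⁻¹
    have s1 := summable_sub_sq hf hf1
    have s2 := summable_sub_sq hf1 (finite_support_comp_mul_left
      (finite_support_comp_mul_left hf y⁻¹) s⁻¹)
    have s3 := summable_sub_sq hf (finite_support_comp_mul_left hf (s * y)⁻¹)
    have key : ∑' x, (walkProb S k x - walkProb S k ((s * y)⁻¹ * x)) ^ 2 ≤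
        ∑' x, ((1 + r) * (walkProb S k x - walkProb S k (s⁻¹ * x)) ^ 2 + (1 + 1 / r) *
          (walkProb S k (s⁻¹ * x) - walkProb S k (y⁻¹ * (s⁻¹ * x))) ^ 2) := by
      refine s3.tsum_le_tsum (fun x => ?_) ((s1.mul_left _).add (s2.mul_left _))
      rw [mul_inv_rev, mul_assoc]
      generalize walkProb S k x = a
      generalize walkProb S k (s⁻¹ * x) = b
      generalize walkProb S k (y⁻¹ * (s⁻¹ * x)) = d
      have h : (1 + r) * (a - b) ^ 2 + (1 + 1 / r) * (b - d) ^ 2 - (a - d) ^ 2 =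
          (r * (a - b) - (b - d)) ^ 2 / r := by
        field_simp
        ring
      have : 0 ≤ (r * (a - b) - (b - d)) ^ 2 / r := by positivity
      linarith
    rw [(s1.mul_left _).tsum_add (s2.mul_left _), tsum_mul_left, tsum_mul_left, n1, n2, n3] at key
    have h1 := mul_le_mul_of_nonneg_left hs (by positivity : 0 ≤ 1 + r)
    have h2 := mul_le_mul_of_nonneg_left ih (by positivity : 0 ≤ 1 + 1 / r)
    have h3 : (1 + r) * D + (1 + 1 / r) * (r ^ 2 * D) = (r + 1) ^ 2 * D := by
      field_simp
      ring
    push_cast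
    linarith

end

end ReturnProbability

section HeatKernel

variable {S : Finset G} (hS : IsSymmGen S)

/-- The set of elements `g` whose word length satisfies `|g|² ≤ k`. -/
noncomputable def IsSymmGen.sqBallFinset (hS : IsSymmGen S) (k : ℕ) : Finset G :=
  (hS.finite_ball (Nat.sqrt k)).toFinset

theorem IsSymmGen.mem_sqBallFinset {k : ℕ} {g : G} :
    g ∈ hS.sqBallFinset k ↔ wordLength S g ^ 2 ≤ k := by
  rw [sqBallFinset, Set.Finite.mem_toFinset, Set.mem_ofPred_eq, Nat.le_sqrt']

theorem IsSymmGen.card_sqBallFinset (k : ℕ) : (hS.sqBallFinset k).card = sqBall S k :=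
  (Set.ncard_eq_toFinset_card _ _).symm

include hS

theorem IsSymmGen.summable_mul_walkProb (f : G → ℝ) (n : ℕ) :
    Summable fun x => f x * walkProb S n x :=
  summable_of_support (hS.finite_support_walkProb n) fun x hx => by simp [hx]

theorem IsSymmGen.summable_walkProb (n : ℕ) : Summable (walkProb S n) :=
  summable_of_support (hS.finite_support_walkProb n) fun _ hx => hx

theorem IsSymmGen.sum_walkProb_le (F : Finset G) (n : ℕ) : ∑ x ∈ F, walkProb S n x ≤ 1 :=
  ((hS.summable_walkProb n).sum_le_tsum F fun _ _ => walkProb_nonneg n _).trans_eq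
    (hS.tsum_walkProb n)

theorem IsSymmGen.sqBall_mul_return_le (k m : ℕ) :
    sqBall S m * walkProb S (2 * k) 1 ≤ 1 + sqBall S m * (m * (numLetters S ^ 2 *
      (walkProb S (2 * k) 1 - walkProb S (2 * (k + 1)) 1))) := by
  have hD : 0 ≤ numLetters S ^ 2 * (walkProb S (2 * k) 1 - walkProb S (2 * (k + 1)) 1) :=
    mul_nonneg (sq_nonneg _) (sub_nonneg.mpr (hS.antitone_return (Nat.le_succ k)))
  set D := numLetters S ^ 2 * (walkProb S (2 * k) 1 - walkProb S (2 * (k + 1)) 1)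
  have h : ∑ y ∈ hS.sqBallFinset m, walkProb S (2 * k) 1 ≤
      ∑ y ∈ hS.sqBallFinset m, (walkProb S (2 * k) y + m * D) := by
    refine Finset.sum_le_sum fun y hy => ?_
    have h1 := hS.return_sub_le k y
    have h2 : (wordLength S y : ℝ) ^ 2 ≤ m := by exact_mod_cast hS.mem_sqBallFinset.mp hy
    have h3 := mul_le_mul_of_nonneg_right h2 hD
    linarith
  rw [Finset.sum_add_distrib, Finset.sum_const, Finset.sum_const, nsmul_eq_mul, nsmul_eq_mul,
    hS.card_sqBallFinset] at h
  have := hS.sum_walkProb_le (hS.sqBallFinset m) (2 * k)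
  linarith

theorem IsSymmGen.exists_return_le (hG : Group.IsNilpotent G) :
    ∃ C : ℝ, 0 < C ∧ ∀ k, walkProb S (2 * k) 1 * sqBall S k ≤ C := by
  obtain ⟨K, hK⟩ := hS.exists_sqBall_doubling hG 2
  obtain ⟨A, hA⟩ := exists_nat_ge (4 * numLetters S ^ 2 * K + 1)
  have hq := numLetters_pos S
  have hA0 : (0 : ℝ) < A := lt_of_lt_of_le (by positivity) hA
  obtain ⟨L, hL⟩ := hS.exists_sqBall_doubling hG A
  have hV : ∀ k, (0 : ℝ) < sqBall S k := fun k => by exact_mod_cast hS.sqBall_pos k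
  refine ⟨max (2 * L) (sqBall S 0), lt_max_of_lt_right (hV 0), fun k => ?_⟩
  induction k using Nat.strong_induction_on with
  | _ k ih =>
    rcases Nat.eq_zero_or_pos k with rfl | hk
    · simp [walkProb_zero]
    set C : ℝ := max (2 * L) (sqBall S 0) with hC
    have ih := ih (k / 2) (by omega)
    set j := k / 2 with hj
    set m := (k + 1) / A with hm
    have hAN : 0 < A := by exact_mod_cast hA0
    have h1 := hS.sqBall_mul_return_le k m
    have h2 := hS.mul_return_sub_le j (k - j)
    rw [show j + (k - j) = k by omega] at h2
    set d := walkProb S (2 * k) 1 - walkProb S (2 * (k + 1)) 1 with hd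
    have hd0 : 0 ≤ d := sub_nonneg.mpr (hS.antitone_return (Nat.le_succ k))
    have hbj := walkProb_nonneg (S := S) (2 * j) 1
    have hbk := walkProb_nonneg (S := S) (2 * k) 1
    set bj := walkProb S (2 * j) 1
    set bk := walkProb S (2 * k) 1
    have hmA : (m : ℝ) * A ≤ k + 1 := by exact_mod_cast Nat.div_mul_le_self (k + 1) A
    have hkj : ((k : ℝ) + 1) ≤ 2 * ((k - j : ℕ) + 1) := by
      have : k + 1 ≤ 2 * (k - j + 1) := by omega
      exact_mod_cast this
    have hVk : (sqBall S k : ℝ) ≤ L * sqBall S m := by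
      have h3 : k ≤ A * (m + 1) := by
        have h := Nat.lt_mul_div_succ (k + 1) hAN
        rw [← hm] at h
        omega
      exact_mod_cast (hS.sqBall_mono h3).trans (hL m)
    have hVk' : (sqBall S k : ℝ) ≤ K * sqBall S j := by
      exact_mod_cast (hS.sqBall_mono (by omega : k ≤ 2 * (j + 1))).trans (hK j)
    have hmd : (m : ℝ) * d * A ≤ 2 * bj := by
      nlinarith [mul_le_mul_of_nonneg_right hmA hd0, mul_le_mul_of_nonneg_right hkj hd0]
    have h4 : (sqBall S m : ℝ) * bk ≤ 1 + sqBall S m * (numLetters S ^ 2 * (2 * bj / A)) := by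
      refine h1.trans ?_
      have : (m : ℝ) * d ≤ 2 * bj / A := (le_div_iff₀ hA0).mpr hmd
      have := mul_le_mul_of_nonneg_left this (sq_nonneg (numLetters S))
      have := mul_le_mul_of_nonneg_left this (hV m).le
      linarith
    have h5 : bk ≤ 1 / sqBall S m + numLetters S ^ 2 * (2 * bj / A) := by
      rw [← mul_le_mul_iff_right₀ (hV m), mul_add, mul_one_div_cancel (hV m).ne']
      exact h4
    have h6 : (1 : ℝ) / sqBall S m * sqBall S k ≤ L := by
      rw [one_div, inv_mul_le_iff₀ (hV m)]
      linarith
    have h7 : numLetters S ^ 2 * (2 * bj / A) * sqBall S k ≤ C / 2 := by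
      have e1 : bj * sqBall S k ≤ K * C := by
        have := mul_le_mul_of_nonneg_left hVk' hbj
        have := mul_le_mul_of_nonneg_left ih (Nat.cast_nonneg (α := ℝ) K)
        linarith
      have hC0 : 0 ≤ C := le_max_of_le_right (hV 0).le
      have e2 : numLetters S ^ 2 * (2 * bj / A) * sqBall S k =
          2 * numLetters S ^ 2 * (bj * sqBall S k) / A := by ring
      rw [e2, div_le_iff₀ hA0]
      have e3 := mul_le_mul_of_nonneg_left e1 (by positivity : 0 ≤ 2 * numLetters S ^ 2)
      have e4 := mul_le_mul_of_nonneg_right hA hC0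
      linarith
    have h8 := mul_le_mul_of_nonneg_right h5 (hV k).le
    have h9 : (2 : ℝ) * L ≤ C := le_max_left _ _
    rw [add_mul] at h8
    linarith

end HeatKernel

section PointwiseEstimates

theorem abs_pow_succ_sub_le (m : ℕ) {D E : ℝ} (hD : 1 ≤ D) (hE : 1 ≤ E) (h : |D - E| ≤ 1) :
    |D ^ (m + 1) - E ^ (m + 1)| ≤ (m + 1) * 2 ^ m * D ^ m := by
  have hED : E ≤ 2 * D := by
    have := (abs_le.mp h).1
    linarith
  have h1 := abs_pow_sub_pow_le D E (m + 1)
  rw [abs_of_nonneg (zero_le_one.trans hD), abs_of_nonneg (zero_le_one.trans hE)] at h1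
  have hmax : max D E ^ m ≤ (2 * D) ^ m :=
    pow_le_pow_left₀ (le_max_of_le_left (zero_le_one.trans hD)) (max_le (by linarith) hED) m
  rw [mul_pow] at hmax
  calc _ ≤ _ := h1
    _ ≤ 1 * ((m + 1 : ℕ) : ℝ) * (2 ^ m * D ^ m) := by
      rw [Nat.add_sub_cancel]
      gcongr
    _ = _ := by push_cast; ring

theorem exists_weighted_gradient_bound (m : ℕ) {q : ℝ} (hq : 0 < q) :
    ∃ C : ℝ, 0 ≤ C ∧ ∀ D E : ℝ, 1 ≤ D → 1 ≤ E → |D - E| ≤ 1 → ∀ u v : ℝ,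
      (D ^ (2 * (m + 1)) * v ^ 2 + E ^ (2 * (m + 1)) * u ^ 2) / 2 ≤
        (D ^ (2 * (m + 1)) * u ^ 2 + E ^ (2 * (m + 1)) * v ^ 2) / 2 +
        1 / q * (D ^ (2 * (m + 1)) * (v - u) ^ 2) +
        C * (D ^ (2 * m) * u ^ 2 + E ^ (2 * m) * v ^ 2) := by
  set c : ℝ := (m + 1) * 2 ^ m with hc
  set L : ℝ := 1 + 2 ^ (m + 1) with hL
  refine ⟨q * L ^ 2 * c ^ 2 / 8, by positivity, fun D E hD hE h u v => ?_⟩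
  have h1 := abs_pow_succ_sub_le m hD hE h
  have h2 := abs_pow_succ_sub_le m hE hD (by rwa [abs_sub_comm])
  rw [← hc] at h1 h2
  rw [abs_sub_comm] at h2
  have hED : E ≤ 2 * D := by
    have := (abs_le.mp h).1
    linarith
  have h3 : D ^ (m + 1) + E ^ (m + 1) ≤ L * D ^ (m + 1) := by
    have := pow_le_pow_left₀ (zero_le_one.trans hE) hED (m + 1)
    rw [mul_pow] at this
    rw [hL]
    linarith
  have h1' : (D ^ (m + 1) - E ^ (m + 1)) ^ 2 ≤ (c * D ^ m) ^ 2 :=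
    sq_le_sq' (abs_le.mp h1).1 (abs_le.mp h1).2
  have h2' : (D ^ (m + 1) - E ^ (m + 1)) ^ 2 ≤ (c * E ^ m) ^ 2 :=
    sq_le_sq' (abs_le.mp h2).1 (abs_le.mp h2).2
  have h3' : (D ^ (m + 1) + E ^ (m + 1)) ^ 2 ≤ (L * D ^ (m + 1)) ^ 2 :=
    pow_le_pow_left₀ (by positivity) h3 2
  rw [show 2 * (m + 1) = (m + 1) * 2 by ring, show 2 * m = m * 2 by ring, pow_mul, pow_mul,
    pow_mul, pow_mul]
  rw [mul_pow] at h1' h2' h3'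
  set a := D ^ (m + 1)
  set b := E ^ (m + 1)
  set d := D ^ m
  set e := E ^ m
  have hLpos : 0 < L := by positivity
  have hX : ((a + b) * (v - u)) ^ 2 / (q * L ^ 2) ≤ 1 / q * (a ^ 2 * (v - u) ^ 2) := by
    rw [div_le_iff₀ (by positivity), mul_pow]
    have e : 1 / q * (a ^ 2 * (v - u) ^ 2) * (q * L ^ 2) = L ^ 2 * a ^ 2 * (v - u) ^ 2 := by
      field_simp
    rw [e]
    exact mul_le_mul_of_nonneg_right h3' (sq_nonneg _)
  have hY : ((a - b) * (v + u)) ^ 2 ≤ 2 * c ^ 2 * (d ^ 2 * u ^ 2 + e ^ 2 * v ^ 2) := by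
    have g1 := mul_le_mul_of_nonneg_right h1' (sq_nonneg u)
    have g2 := mul_le_mul_of_nonneg_right h2' (sq_nonneg v)
    have g3 : ((a - b) * (v + u)) ^ 2 ≤ (a - b) ^ 2 * (2 * (u ^ 2 + v ^ 2)) := by
      rw [mul_pow]
      refine mul_le_mul_of_nonneg_left ?_ (sq_nonneg _)
      linarith [sq_nonneg (v - u)]
    linarith
  have hXY : (a + b) * (v - u) * ((a - b) * (v + u)) / 2 ≤
      ((a + b) * (v - u)) ^ 2 / (q * L ^ 2) + q * L ^ 2 / 16 * ((a - b) * (v + u)) ^ 2 := by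
    generalize (a + b) * (v - u) = X
    generalize (a - b) * (v + u) = Y
    have hp : 0 < q * L ^ 2 := by positivity
    generalize q * L ^ 2 = p at hp
    have h : X ^ 2 / p + p / 16 * Y ^ 2 - X * Y / 2 = (X - p / 4 * Y) ^ 2 / p := by
      field_simp
      ring
    have : 0 ≤ (X - p / 4 * Y) ^ 2 / p := by positivity
    linarith
  have hY' := mul_le_mul_of_nonneg_left hY (by positivity : 0 ≤ q * L ^ 2 / 16)
  linarith

theorem sq_sum_option_le {ι : Type*} [Fintype ι] (f : Option ι → ℝ) :
    (∑ a, f a) ^ 2 + ∑ a, (f a - f none) ^ 2 ≤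
      (Fintype.card (Option ι) : ℝ) * ∑ a, f a ^ 2 := by
  have hcs := sq_sum_le_card_mul_sum_sq (s := Finset.univ) (f := fun i : ι => f (some i) - f none)
  simp only [Fintype.sum_option, Fintype.card_option, Finset.card_univ, sub_sq,
    Finset.sum_add_distrib, Finset.sum_sub_distrib, ← Finset.sum_mul, ← Finset.mul_sum,
    Finset.sum_const, nsmul_eq_mul] at hcs ⊢
  push_cast
  nlinarith

end PointwiseEstimates

section WeightedMoments

variable {S : Finset G} (hS : IsSymmGen S)

/-- The weighted second moment `∑ₓ (1 + |x|)²ᵐ pₜ(x)²`. -/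
noncomputable def sqMoment (S : Finset G) (m t : ℕ) : ℝ :=
  ∑' x, (1 + (wordLength S x : ℝ)) ^ (2 * m) * walkProb S t x ^ 2

theorem sqMoment_nonneg (m t : ℕ) : 0 ≤ sqMoment S m t :=
  tsum_nonneg fun _ => by positivity

include hS

theorem IsSymmGen.summable_mul_walkProb_sq (f : G → ℝ) (t : ℕ) :
    Summable fun x => f x * walkProb S t x ^ 2 :=
  summable_of_support (hS.finite_support_walkProb t) fun x hx => by simp [hx]

theorem IsSymmGen.exists_sqMoment_succ_le (m : ℕ) : ∃ C : ℝ, 0 ≤ C ∧ ∀ t,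
    sqMoment S (m + 1) (t + 1) ≤ sqMoment S (m + 1) t + C * sqMoment S m t := by
  have hq := numLetters_pos S
  obtain ⟨C, hC, HC⟩ := exists_weighted_gradient_bound m hq
  refine ⟨2 * C, by positivity, fun t => ?_⟩
  set q := numLetters S with hq_def
  set W : ℕ → G → ℝ := fun k x => (1 + (wordLength S x : ℝ)) ^ (2 * k) with hW
  set p := walkProb S t with hp
  have hfin := hS.finite_support_walkProb t
  have hs0 : ∀ f : G → ℝ, Summable fun x => f x * p x ^ 2 := fun f =>
    hS.summable_mul_walkProb_sq f t
  have hs1 : ∀ (f : G → ℝ) (a : G), Summable fun x => f x * p (x * a) ^ 2 := fun f a =>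
    summable_of_support (finite_support_comp_mul_right hfin a) fun x hx => by simp [hp, hx]
  have hs2 : ∀ (f : G → ℝ) (a : G), Summable fun x => f x * (p (x * a) - p x) ^ 2 := fun f a => by
    have h := ((hs1 f a).sub ((summable_of_support (g := fun x => 2 * f x * p (x * a) * p x) hfin
      fun x hx => by simp [hp, hx]))).add (hs0 f)
    exact h.congr fun x => by ring
  have hshift : ∀ (f : G → ℝ) (a : G), ∑' x, f (x * a) * p (x * a) ^ 2 = ∑' x, f x * p x ^ 2 :=
    fun f a => tsum_mul_right_shift (fun x => f x * p x ^ 2) a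
  have hpt : ∀ x, q * (W (m + 1) x * walkProb S (t + 1) x ^ 2) ≤
      ∑ a : Option {x // x ∈ S}, (W (m + 1) x * p (x * lazyVal a) ^ 2 -
        1 / q * (W (m + 1) x * (p (x * lazyVal a) - p x) ^ 2)) := by
    intro x
    have h := sq_sum_option_le fun a : Option {x // x ∈ S} => p (x * lazyVal a)
    rw [card_letters, show (lazyVal (none : Option {x // x ∈ S}) : G) = 1 from rfl, mul_one] at h
    rw [Finset.sum_sub_distrib, ← Finset.mul_sum, ← Finset.mul_sum, ← Finset.mul_sum,
      walkProb_succ, avg, div_pow]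
    have hWx : 0 ≤ W (m + 1) x := by positivity
    have h' := mul_le_mul_of_nonneg_left h (div_nonneg hWx hq.le)
    have e1 : q * (W (m + 1) x * ((∑ a : Option {x // x ∈ S}, p (x * lazyVal a)) ^ 2 / q ^ 2)) =
        W (m + 1) x / q * (∑ a : Option {x // x ∈ S}, p (x * lazyVal a)) ^ 2 := by
      field_simp
    have e2 : W (m + 1) x * ∑ a : Option {x // x ∈ S}, p (x * lazyVal a) ^ 2 =
        W (m + 1) x / q * (q * ∑ a : Option {x // x ∈ S}, p (x * lazyVal a) ^ 2) := by
      field_simp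
    rw [e1, e2]
    have e3 : 1 / q * (W (m + 1) x * ∑ a : Option {x // x ∈ S}, (p (x * lazyVal a) - p x) ^ 2) =
        W (m + 1) x / q * ∑ a : Option {x // x ∈ S}, (p (x * lazyVal a) - p x) ^ 2 := by
      ring
    rw [e3]
    linarith
  have hsum : q * sqMoment S (m + 1) (t + 1) ≤ ∑ a : Option {x // x ∈ S},
      (∑' x, W (m + 1) x * p (x * lazyVal a) ^ 2 -
        1 / q * ∑' x, W (m + 1) x * (p (x * lazyVal a) - p x) ^ 2) := by
    rw [sqMoment, ← tsum_mul_left]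
    refine (((hS.summable_mul_walkProb_sq _ _).mul_left q).tsum_le_tsum hpt
      (summable_sum fun a _ => (hs1 _ _).sub ((hs2 _ _).mul_left _))).trans_eq ?_
    rw [Summable.tsum_finsetSum fun a _ => (hs1 _ _).sub ((hs2 _ _).mul_left _)]
    refine Finset.sum_congr rfl fun a _ => ?_
    rw [(hs1 _ _).tsum_sub ((hs2 _ _).mul_left _), tsum_mul_left]
  have hsymm : ∑ a : Option {x // x ∈ S}, ∑' x, W (m + 1) x * p (x * lazyVal a) ^ 2 =
      ∑ a : Option {x // x ∈ S}, ∑' x, W (m + 1) (x * lazyVal a) * p x ^ 2 := by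
    rw [← hS.sum_letters_inv fun a => ∑' x, W (m + 1) (x * a) * p x ^ 2]
    refine Finset.sum_congr rfl fun a _ => ?_
    rw [← tsum_mul_right_shift (fun x => W (m + 1) (x * (lazyVal a)⁻¹) * p x ^ 2) (lazyVal a)]
    simp
  have hletter : ∀ a : Option {x // x ∈ S},
      (∑' x, W (m + 1) x * p (x * lazyVal a) ^ 2 +
        ∑' x, W (m + 1) (x * lazyVal a) * p x ^ 2) / 2 ≤
      sqMoment S (m + 1) t + 1 / q * ∑' x, W (m + 1) x * (p (x * lazyVal a) - p x) ^ 2 +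
        2 * C * sqMoment S m t := by
    intro a
    have hD : ∀ x, |(1 + (wordLength S x : ℝ)) - (1 + (wordLength S (x * lazyVal a) : ℝ))| ≤ 1 := by
      intro x
      have h1 := hS.wordLength_mul_le x (lazyVal a)
      have h2 := hS.wordLength_mul_le (x * lazyVal a) (lazyVal a)⁻¹
      rw [hS.wordLength_inv, mul_inv_cancel_right] at h2
      have h3 := wordLength_lazyVal_le a
      have h4 : (wordLength S (x * lazyVal a) : ℝ) ≤ wordLength S x + 1 := by
        exact_mod_cast h1.trans (by omega)
      have h5 : (wordLength S x : ℝ) ≤ wordLength S (x * lazyVal a) + 1 := by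
        exact_mod_cast h2.trans (by omega)
      rw [abs_le]
      constructor <;> linarith
    have hle := Summable.tsum_le_tsum (fun x => HC _ _ (by simp) (by simp) (hD x) (p x)
        (p (x * lazyVal a)))
      (((hs1 (W (m + 1)) (lazyVal a)).add (hs0 fun x => W (m + 1) (x * lazyVal a))).div_const 2)
      (((((hs0 (W (m + 1))).add (hs1 (fun x => W (m + 1) (x * lazyVal a)) (lazyVal a))).div_const
        2).add ((hs2 (W (m + 1)) (lazyVal a)).mul_left (1 / q))).add
        (((hs0 (W m)).add (hs1 (fun x => W m (x * lazyVal a)) (lazyVal a))).mul_left C))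
    rw [tsum_div_const, Summable.tsum_add (hs1 (W (m + 1)) (lazyVal a))
        (hs0 fun x => W (m + 1) (x * lazyVal a)),
      Summable.tsum_add ((((hs0 (W (m + 1))).add
        (hs1 (fun x => W (m + 1) (x * lazyVal a)) (lazyVal a))).div_const
        2).add ((hs2 (W (m + 1)) (lazyVal a)).mul_left (1 / q)))
        (((hs0 (W m)).add (hs1 (fun x => W m (x * lazyVal a)) (lazyVal a))).mul_left C),
      Summable.tsum_add (((hs0 (W (m + 1))).add
        (hs1 (fun x => W (m + 1) (x * lazyVal a)) (lazyVal a))).div_const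
        2) ((hs2 (W (m + 1)) (lazyVal a)).mul_left (1 / q)), tsum_div_const,
      Summable.tsum_add (hs0 (W (m + 1)))
        (hs1 (fun x => W (m + 1) (x * lazyVal a)) (lazyVal a)), tsum_mul_left, tsum_mul_left,
      Summable.tsum_add (hs0 (W m)) (hs1 (fun x => W m (x * lazyVal a)) (lazyVal a)),
      hshift, hshift] at hle
    have em : ∀ k, ∑' x, W k x * p x ^ 2 = sqMoment S k t := fun _ => rfl
    rw [em, em] at hle
    linarith
  have hfinal := Finset.sum_le_sum fun a (_ : a ∈ Finset.univ) => hletter a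
  rw [Finset.sum_add_distrib, Finset.sum_add_distrib, sum_letters_const, sum_letters_const,
    ← Finset.sum_div, Finset.sum_add_distrib, ← hsymm, ← Finset.mul_sum] at hfinal
  rw [Finset.sum_sub_distrib, ← Finset.mul_sum] at hsum
  rw [← mul_le_mul_iff_right₀ hq]
  linarith

end WeightedMoments

section MomentGrowth

variable {S : Finset G} (hS : IsSymmGen S)
include hS

theorem IsSymmGen.sqMoment_le_young (m s : ℕ) {T : ℝ} (hT : 0 < T) :
    sqMoment S m s ≤ 1 / T * sqMoment S (m + 1) s + T ^ m * walkProb S (2 * s) 1 := by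
  rw [← hS.tsum_walkProb_sq, sqMoment, sqMoment, ← tsum_mul_left, ← tsum_mul_left,
    ← ((hS.summable_mul_walkProb_sq _ s).mul_left _).tsum_add
      (hS.summable_mul_walkProb_sq _ s)]
  refine (hS.summable_mul_walkProb_sq _ s).tsum_le_tsum (fun x => ?_)
    (((hS.summable_mul_walkProb_sq _ s).mul_left _).add (hS.summable_mul_walkProb_sq _ s))
  rw [← mul_assoc, ← add_mul]
  refine mul_le_mul_of_nonneg_right ?_ (sq_nonneg _)
  rw [pow_mul, pow_mul]
  have hy : 0 ≤ (1 + (wordLength S x : ℝ)) ^ 2 := sq_nonneg _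
  generalize (1 + (wordLength S x : ℝ)) ^ 2 = y at hy
  rcases le_total T y with h | h
  · have h1 : y ^ m ≤ 1 / T * y ^ (m + 1) := by
      rw [one_div, ← div_eq_inv_mul, le_div_iff₀ hT, pow_succ]
      gcongr
    have : 0 ≤ T ^ m := by positivity
    linarith
  · have h1 : y ^ m ≤ T ^ m := by gcongr
    have : 0 ≤ 1 / T * y ^ (m + 1) := by positivity
    linarith

theorem IsSymmGen.exists_sqMoment_step (m : ℕ) : ∃ C : ℝ, 0 ≤ C ∧ ∀ t : ℕ, 1 ≤ t →
    ∀ t' : ℕ, t ≤ t' → t' ≤ 2 * t + 1 → sqMoment S (m + 1) t' ≤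
      8 * sqMoment S (m + 1) t + C * (t : ℝ) ^ (m + 1) * walkProb S (2 * t) 1 := by
  obtain ⟨C₀, hC₀, H⟩ := hS.exists_sqMoment_succ_le m
  set C := C₀ + 1 with hC_def
  have hC : 0 < C := by positivity
  refine ⟨16 * C ^ (m + 1), by positivity, fun t ht t' htt' ht' => ?_⟩
  have ht0 : (0 : ℝ) < t := by exact_mod_cast ht
  have ht1 : (1 : ℝ) ≤ t := by exact_mod_cast ht
  have hb := walkProb_nonneg (S := S) (2 * t) 1
  set E := C * ((C * t) ^ m * walkProb S (2 * t) 1) with hE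
  have hE0 : 0 ≤ E := by positivity
  have hM := sqMoment_nonneg (S := S) (m + 1) t
  have hstep : ∀ s, t ≤ s → sqMoment S (m + 1) (s + 1) ≤
      (1 + 1 / t) * sqMoment S (m + 1) s + E := by
    intro s hs
    have h1 := H s
    have h2 := hS.sqMoment_le_young m s (mul_pos hC ht0)
    have h3 : walkProb S (2 * s) 1 ≤ walkProb S (2 * t) 1 := hS.antitone_return hs
    have h4 := sqMoment_nonneg (S := S) m s
    have h5 : C₀ * sqMoment S m s ≤ C * sqMoment S m s :=
      mul_le_mul_of_nonneg_right (by linarith) h4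
    have h6 : C * sqMoment S m s ≤ C * (1 / (C * t) * sqMoment S (m + 1) s +
        (C * t) ^ m * walkProb S (2 * t) 1) := by
      refine mul_le_mul_of_nonneg_left (h2.trans ?_) hC.le
      gcongr
    have h7 : C * (1 / (C * t) * sqMoment S (m + 1) s) = 1 / t * sqMoment S (m + 1) s := by
      field_simp
    rw [mul_add, h7] at h6
    linarith
  have hiter : ∀ i : ℕ, sqMoment S (m + 1) (t + i) ≤
      (1 + 1 / (t : ℝ)) ^ i * (sqMoment S (m + 1) t + i * E) := by
    intro i
    induction i with
    | zero => simp
    | succ i ih =>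
      have h1 := hstep (t + i) (by omega)
      have hr : 1 ≤ 1 + 1 / (t : ℝ) := by
        have : 0 ≤ 1 / (t : ℝ) := by positivity
        linarith
      have h2 := mul_le_mul_of_nonneg_left ih (zero_le_one.trans hr)
      have h3 : E ≤ (1 + 1 / (t : ℝ)) ^ (i + 1) * E :=
        le_mul_of_one_le_left hE0 (one_le_pow₀ hr)
      rw [← add_assoc]
      push_cast
      rw [pow_succ'] at h3 ⊢
      linarith
  obtain ⟨i, rfl⟩ := Nat.exists_eq_add_of_le htt'
  have hi : (i : ℝ) ≤ 2 * t := by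
    have : i ≤ 2 * t := by omega
    exact_mod_cast this
  have hpow : (1 + 1 / (t : ℝ)) ^ i ≤ 8 := by
    have h1 : (1 + 1 / (t : ℝ)) ^ i ≤ Real.exp (1 / t) ^ i := by
      gcongr
      rw [add_comm]
      exact Real.add_one_le_exp _
    have h2 : Real.exp (1 / t) ^ i ≤ Real.exp 2 := by
      rw [← Real.exp_nat_mul]
      refine Real.exp_le_exp.mpr ?_
      rw [mul_one_div, div_le_iff₀ ht0]
      exact hi
    have h3 : Real.exp 2 ≤ 8 := by
      rw [show (2 : ℝ) = 1 + 1 by norm_num, Real.exp_add]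
      nlinarith [Real.exp_one_lt_d9, Real.exp_pos 1]
    linarith
  have hs0 : 0 ≤ sqMoment S (m + 1) t + i * E := by positivity
  calc _ ≤ _ := hiter i
    _ ≤ 8 * (sqMoment S (m + 1) t + 2 * t * E) := by gcongr
    _ = _ := by rw [hE, mul_pow, pow_succ C, pow_succ (t : ℝ)]; ring

theorem IsSymmGen.exists_sqMoment_le (hG : Group.IsNilpotent G) : ∃ m₀ : ℕ, ∀ m, m₀ ≤ m →
    ∃ B : ℝ, 0 ≤ B ∧ ∀ t : ℕ, 1 ≤ t → sqMoment S m t * sqBall S t ≤ B * (t : ℝ) ^ m := by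
  obtain ⟨K, hK⟩ := hS.exists_sqBall_doubling hG 2
  obtain ⟨H, hH, hret⟩ := hS.exists_return_le hG
  obtain ⟨m₀, hm₀⟩ := pow_unbounded_of_one_lt (16 * K : ℝ) one_lt_two
  refine ⟨m₀ + 1, fun m hm => ?_⟩
  obtain ⟨m, rfl⟩ := Nat.exists_eq_add_of_le' (by omega : 1 ≤ m)
  have hm2 : (16 * K : ℝ) ≤ 2 ^ (m + 1) :=
    hm₀.le.trans (pow_le_pow_right₀ one_le_two (by omega))
  obtain ⟨C, hC, hstep⟩ := hS.exists_sqMoment_step m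
  have hV : ∀ k, (0 : ℝ) < sqBall S k := fun k => by exact_mod_cast hS.sqBall_pos k
  have hM1 := sqMoment_nonneg (S := S) (m + 1) 1
  set B : ℝ := 2 * (C * H * K) + sqMoment S (m + 1) 1 * sqBall S 1 with hB
  have hB0 : 0 ≤ B := by have := hV 1; positivity
  refine ⟨B, hB0, fun t => ?_⟩
  induction t using Nat.strong_induction_on with
  | _ n ih =>
    intro hn
    rcases hn.eq_or_lt with rfl | hn
    · have : 0 ≤ C * H * K := by positivity
      rw [Nat.cast_one, one_pow, mul_one]
      linarith
    · set t := n / 2 with ht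
      have ih := ih t (by omega) (by omega)
      have h1 := hstep t (by omega) n (by omega) (by omega)
      have hVn : (sqBall S n : ℝ) ≤ K * sqBall S t := by
        exact_mod_cast (hS.sqBall_mono (by omega : n ≤ 2 * (t + 1))).trans (hK t)
      have hMt := sqMoment_nonneg (S := S) (m + 1) t
      have hbt := walkProb_nonneg (S := S) (2 * t) 1
      have hpn : 2 ^ (m + 1) * (t : ℝ) ^ (m + 1) ≤ (n : ℝ) ^ (m + 1) := by
        rw [← mul_pow]
        have : 2 * t ≤ n := by omega
        gcongr
        exact_mod_cast this
      have hpn' : (t : ℝ) ^ (m + 1) ≤ (n : ℝ) ^ (m + 1) := by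
        have : t ≤ n := by omega
        gcongr
      have hret := hret t
      have hVt := hV t
      have hVn0 := hV n
      have hMn := sqMoment_nonneg (S := S) (m + 1) n
      set b := walkProb S (2 * t) 1
      set T : ℝ := (t : ℝ) ^ (m + 1)
      have hT : 0 ≤ T := by positivity
      set N : ℝ := (n : ℝ) ^ (m + 1)
      calc sqMoment S (m + 1) n * sqBall S n
          ≤ (8 * sqMoment S (m + 1) t + C * T * b) * (K * sqBall S t) := by gcongr
        _ = 8 * K * (sqMoment S (m + 1) t * sqBall S t) + C * T * K * (b * sqBall S t) := by ring
        _ ≤ 8 * K * (B * T) + C * T * K * H := by gcongr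
        _ = 16 * K * (B / 2 * T) + C * H * K * T := by ring
        _ ≤ 2 ^ (m + 1) * (B / 2 * T) + C * H * K * T := by gcongr
        _ = B / 2 * (2 ^ (m + 1) * T) + C * H * K * T := by ring
        _ ≤ B / 2 * N + C * H * K * N := by gcongr
        _ ≤ B * N := by
          have h2 : C * H * K ≤ B / 2 := by
            have := mul_nonneg hM1 (hV 1).le
            rw [hB]
            linarith
          have hN : 0 ≤ N := hT.trans hpn'
          have := mul_le_mul_of_nonneg_right h2 hN
          linarith

end MomentGrowth

section WalkMoments

variable {S : Finset G} (hS : IsSymmGen S)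
include hS

theorem IsSymmGen.exists_weighted_sq_le (hG : Group.IsNilpotent G) : ∃ m₀ : ℕ, ∀ m, m₀ ≤ m →
    ∃ B : ℝ, 0 ≤ B ∧ ∀ t : ℕ, 1 ≤ t →
      sqBall S t * ∑' x, (1 + (wordLength S x : ℝ) ^ 2 / t) ^ m * walkProb S t x ^ 2 ≤ B := by
  obtain ⟨m₀, h₀⟩ := hS.exists_sqMoment_le hG
  obtain ⟨H, hH, hret⟩ := hS.exists_return_le hG
  refine ⟨m₀, fun m hm => ?_⟩
  obtain ⟨B, hB, hBt⟩ := h₀ m hm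
  refine ⟨2 ^ (m - 1) * (H + B), by positivity, fun t ht => ?_⟩
  have ht0 : (0 : ℝ) < t := by exact_mod_cast ht
  have hV : (0 : ℝ) < sqBall S t := by exact_mod_cast hS.sqBall_pos t
  have hpt : ∀ x : G, (1 + (wordLength S x : ℝ) ^ 2 / t) ^ m * walkProb S t x ^ 2 ≤
      2 ^ (m - 1) * (walkProb S t x ^ 2 + 1 / (t : ℝ) ^ m *
        ((1 + (wordLength S x : ℝ)) ^ (2 * m) * walkProb S t x ^ 2)) := by
    intro x
    have h1 : (1 + (wordLength S x : ℝ) ^ 2 / t) ^ m ≤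
        2 ^ (m - 1) * (1 ^ m + ((wordLength S x : ℝ) ^ 2 / t) ^ m) :=
      add_pow_le zero_le_one (by positivity) m
    have h2 : ((wordLength S x : ℝ) ^ 2 / t) ^ m ≤
        1 / (t : ℝ) ^ m * (1 + (wordLength S x : ℝ)) ^ (2 * m) := by
      rw [div_pow, ← pow_mul, div_eq_mul_one_div, mul_comm]
      gcongr
      linarith
    calc _ ≤ 2 ^ (m - 1) * (1 + 1 / (t : ℝ) ^ m * (1 + (wordLength S x : ℝ)) ^ (2 * m)) *
          walkProb S t x ^ 2 := by
          refine mul_le_mul_of_nonneg_right (h1.trans ?_) (sq_nonneg _)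
          rw [one_pow]
          gcongr
      _ = _ := by ring
  have hs1 : Summable fun x => walkProb S t x ^ 2 := by
    simpa using hS.summable_mul_walkProb_sq (fun _ => 1) t
  have hs2 := (hS.summable_mul_walkProb_sq
    (fun x => (1 + (wordLength S x : ℝ)) ^ (2 * m)) t).mul_left (1 / (t : ℝ) ^ m)
  have hsum : ∑' x, (1 + (wordLength S x : ℝ) ^ 2 / t) ^ m * walkProb S t x ^ 2 ≤
      2 ^ (m - 1) * (walkProb S (2 * t) 1 + 1 / (t : ℝ) ^ m * sqMoment S m t) := by
    refine ((hS.summable_mul_walkProb_sq _ t).tsum_le_tsum hpt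
      ((hs1.add hs2).mul_left _)).trans_eq ?_
    rw [tsum_mul_left, hs1.tsum_add hs2, tsum_mul_left, hS.tsum_walkProb_sq, sqMoment]
  have h3 : 1 / (t : ℝ) ^ m * (sqMoment S m t * sqBall S t) ≤ B := by
    rw [one_div, ← div_eq_inv_mul, div_le_iff₀ (by positivity)]
    exact hBt t ht
  calc _ ≤ sqBall S t *
        (2 ^ (m - 1) * (walkProb S (2 * t) 1 + 1 / (t : ℝ) ^ m * sqMoment S m t)) := by gcongr
    _ = 2 ^ (m - 1) * (walkProb S (2 * t) 1 * sqBall S t +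
        1 / (t : ℝ) ^ m * (sqMoment S m t * sqBall S t)) := by ring
    _ ≤ _ := by
      have := hret t
      gcongr

omit hS in
theorem inv_one_add_pow_le_sum_indicator {d t : ℕ} (ht : 1 ≤ t) (hdt : d ≤ t) (n : ℕ) :
    ((1 + (d : ℝ) ^ 2 / t) ^ n)⁻¹ ≤ ∑ i ∈ Finset.range (t + 1),
      if d ^ 2 ≤ 2 ^ i * t then 2 ^ n * ((1 / 2 : ℝ) ^ n) ^ i else 0 := by
  have ht0 : (0 : ℝ) < t := by exact_mod_cast ht
  have hex : ∃ i, d ^ 2 ≤ 2 ^ i * t := ⟨t, by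
    rw [sq]
    exact Nat.mul_le_mul (hdt.trans Nat.lt_two_pow_self.le) hdt⟩
  obtain ⟨i, hi, hmin⟩ : ∃ i, d ^ 2 ≤ 2 ^ i * t ∧ ∀ j < i, ¬ d ^ 2 ≤ 2 ^ j * t :=
    ⟨Nat.find hex, Nat.find_spec hex, fun j hj => Nat.find_min hex hj⟩
  have hit : i ≤ t := by
    by_contra! h
    refine hmin t h ?_
    rw [sq]
    exact Nat.mul_le_mul (hdt.trans Nat.lt_two_pow_self.le) hdt
  have h2 : (2 : ℝ) ^ i ≤ 2 * (1 + (d : ℝ) ^ 2 / t) := by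
    have hz : 0 ≤ (d : ℝ) ^ 2 / t := by positivity
    rcases i with _ | i
    · rw [pow_zero]; linarith
    · have h3 := not_le.mp (hmin i (Nat.lt_succ_self i))
      have h4 : (2 : ℝ) ^ i ≤ (d : ℝ) ^ 2 / t := by
        rw [le_div_iff₀ ht0]
        exact_mod_cast h3.le
      rw [pow_succ]; linarith
  have h5 : ((1 + (d : ℝ) ^ 2 / t) ^ n)⁻¹ ≤ 2 ^ n * ((1 / 2 : ℝ) ^ n) ^ i := by
    rw [inv_le_iff_one_le_mul₀' (by positivity), ← pow_mul, mul_comm n i, pow_mul, ← mul_pow,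
      ← mul_pow]
    refine one_le_pow₀ ?_
    rw [one_div, inv_pow, ← mul_assoc, ← div_eq_mul_inv, one_le_div (by positivity)]
    linarith
  refine h5.trans ?_
  have h6 := Finset.single_le_sum (f := fun i =>
    if d ^ 2 ≤ 2 ^ i * t then 2 ^ n * ((1 / 2 : ℝ) ^ n) ^ i else 0) (fun j _ => by
      split_ifs <;> positivity) (Finset.mem_range.mpr (Nat.lt_succ_of_le hit))
  simpa only [if_pos hi] using h6

theorem IsSymmGen.exists_sum_inv_le (hG : Group.IsNilpotent G) : ∃ n₀ : ℕ, ∀ n, n₀ ≤ n →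
    ∃ B : ℝ, 0 ≤ B ∧ ∀ t : ℕ, 1 ≤ t → ∀ F : Finset G, (∀ x ∈ F, wordLength S x ≤ t) →
      ∑ x ∈ F, ((1 + (wordLength S x : ℝ) ^ 2 / t) ^ n)⁻¹ ≤ B * sqBall S t := by
  obtain ⟨K, hK⟩ := hS.exists_sqBall_doubling hG 2
  obtain ⟨n₀, hn₀⟩ := pow_unbounded_of_one_lt (2 * K : ℝ) one_lt_two
  refine ⟨n₀, fun n hn => ⟨2 ^ n * 2, by positivity, fun t ht F hF => ?_⟩⟩
  have hV : (0 : ℝ) < sqBall S t := by exact_mod_cast hS.sqBall_pos t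
  have hKn : (K : ℝ) * (1 / 2) ^ n ≤ 1 / 2 := by
    have h1 : (2 * K : ℝ) ≤ 2 ^ n := hn₀.le.trans (pow_le_pow_right₀ one_le_two hn)
    rw [one_div, inv_pow, ← div_eq_mul_inv, div_le_iff₀ (by positivity)]
    linarith
  have hball : ∀ i : ℕ, (sqBall S (2 ^ i * t) : ℝ) ≤ K ^ i * sqBall S t := by
    intro i
    induction i with
    | zero => simp
    | succ i ih =>
      have h1 : (sqBall S (2 ^ (i + 1) * t) : ℝ) ≤ K * sqBall S (2 ^ i * t) := by
        exact_mod_cast (hS.sqBall_mono (by rw [pow_succ]; lia :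
          2 ^ (i + 1) * t ≤ 2 * (2 ^ i * t + 1))).trans (hK _)
      calc _ ≤ _ := h1
        _ ≤ K * (K ^ i * sqBall S t) := by gcongr
        _ = _ := by ring
  have hinner : ∀ i ∈ Finset.range (t + 1), ∑ x ∈ F,
      (if wordLength S x ^ 2 ≤ 2 ^ i * t then 2 ^ n * ((1 / 2 : ℝ) ^ n) ^ i else 0) ≤
        2 ^ n * sqBall S t * (1 / 2) ^ i := by
    intro i _
    rw [← Finset.sum_filter, Finset.sum_const, nsmul_eq_mul]
    have hcard : ((F.filter fun x => wordLength S x ^ 2 ≤ 2 ^ i * t).card : ℝ) ≤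
        K ^ i * sqBall S t := by
      refine le_trans ?_ (hball i)
      rw [← hS.card_sqBallFinset]
      exact_mod_cast Finset.card_le_card fun x hx =>
        hS.mem_sqBallFinset.mpr (Finset.mem_filter.mp hx).2
    calc _ ≤ K ^ i * sqBall S t * (2 ^ n * ((1 / 2 : ℝ) ^ n) ^ i) := by gcongr
      _ = 2 ^ n * sqBall S t * (K * (1 / 2) ^ n) ^ i := by rw [mul_pow]; ring
      _ ≤ _ := by gcongr
  calc _ ≤ ∑ x ∈ F, ∑ i ∈ Finset.range (t + 1),
        (if wordLength S x ^ 2 ≤ 2 ^ i * t then 2 ^ n * ((1 / 2 : ℝ) ^ n) ^ i else 0) :=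
        Finset.sum_le_sum fun x hx => inv_one_add_pow_le_sum_indicator ht (hF x hx) n
    _ ≤ ∑ i ∈ Finset.range (t + 1), 2 ^ n * sqBall S t * (1 / 2 : ℝ) ^ i := by
      rw [Finset.sum_comm]
      exact Finset.sum_le_sum hinner
    _ = 2 ^ n * sqBall S t * ∑ i ∈ Finset.range (t + 1), (1 / 2 : ℝ) ^ i := by
      rw [Finset.mul_sum]
    _ ≤ 2 ^ n * sqBall S t * 2 := by
      gcongr
      exact sum_geometric_two_le _
    _ = _ := by ring

theorem IsSymmGen.exists_moment_le (hG : Group.IsNilpotent G) (j : ℕ) :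
    ∃ C : ℝ, 0 < C ∧ ∀ t : ℕ, 1 ≤ t →
      ∑' x, (wordLength S x : ℝ) ^ j * walkProb S t x ≤ C * √t ^ j := by
  obtain ⟨m₀, hm₀⟩ := hS.exists_weighted_sq_le hG
  obtain ⟨n₀, hn₀⟩ := hS.exists_sum_inv_le hG
  set n := max m₀ n₀
  obtain ⟨B₁, hB₁, h₁⟩ := hm₀ (j + n) (by lia)
  obtain ⟨B₂, hB₂, h₂⟩ := hn₀ n (le_max_right _ _)
  refine ⟨B₁ + B₂ + 1, by positivity, fun t ht => ?_⟩
  have ht0 : (0 : ℝ) < t := by exact_mod_cast ht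
  have hV : (0 : ℝ) < sqBall S t := by exact_mod_cast hS.sqBall_pos t
  have h₁ := h₁ t ht
  set F := hS.sqBallFinset (t ^ 2)
  have hF : ∀ x ∈ F, wordLength S x ≤ t := fun x hx =>
    (Nat.pow_le_pow_iff_left two_ne_zero).mp (hS.mem_sqBallFinset.mp hx)
  have hF' : ∀ x ∉ F, walkProb S t x = 0 := fun x hx => by
    by_contra h
    exact hx (hS.mem_sqBallFinset.mpr
      (Nat.pow_le_pow_left (hS.wordLength_le_of_walkProb_ne_zero h) 2))
  have h₂ := h₂ t ht F hF
  have hsF : ∑ x ∈ F, (1 + (wordLength S x : ℝ) ^ 2 / t) ^ (j + n) * walkProb S t x ^ 2 ≤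
      ∑' x, (1 + (wordLength S x : ℝ) ^ 2 / t) ^ (j + n) * walkProb S t x ^ 2 :=
    (hS.summable_mul_walkProb_sq _ t).sum_le_tsum _ fun _ _ => by positivity
  have hpt : ∀ x, (wordLength S x : ℝ) ^ j * walkProb S t x ≤ √t ^ j *
      (sqBall S t * ((1 + (wordLength S x : ℝ) ^ 2 / t) ^ (j + n) * walkProb S t x ^ 2) +
        (sqBall S t : ℝ)⁻¹ * ((1 + (wordLength S x : ℝ) ^ 2 / t) ^ n)⁻¹) := by
    intro x
    have hy : (wordLength S x : ℝ) = √t * (wordLength S x / √t) := by field_simp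
    have hz : (wordLength S x : ℝ) ^ 2 / t = (wordLength S x / √t) ^ 2 := by
      rw [div_pow, Real.sq_sqrt ht0.le]
    rw [hz]
    nth_rewrite 1 [hy]
    have hy0 : 0 ≤ (wordLength S x : ℝ) / √t := by positivity
    generalize (wordLength S x : ℝ) / √t = y at hy0
    rw [mul_pow, mul_assoc]
    refine mul_le_mul_of_nonneg_left ?_ (by positivity)
    have hp := walkProb_nonneg (S := S) t x
    generalize walkProb S t x = p at hp
    have hu : 1 ≤ 1 + y ^ 2 := by nlinarith
    set u := 1 + y ^ 2
    have hYu : (y ^ j) ^ 2 ≤ u ^ j := by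
      rw [← pow_mul, mul_comm, pow_mul]
      gcongr
      simp [u]
    have hun : 0 < u ^ n := by positivity
    have hW : 0 < (sqBall S t : ℝ) * u ^ n := by positivity
    have key : y ^ j * p ≤
        (sqBall S t * u ^ n) * (y ^ j * p) ^ 2 + ((sqBall S t : ℝ) * u ^ n)⁻¹ := by
      set W := (sqBall S t : ℝ) * u ^ n
      set a := y ^ j * p
      have h : 0 ≤ W⁻¹ * (W * a - 1) ^ 2 := by positivity
      have h' : W⁻¹ * (W * a - 1) ^ 2 = W * a ^ 2 - 2 * a + W⁻¹ := by field_simp; ring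
      have ha : 0 ≤ a := by positivity
      linarith
    refine key.trans ?_
    rw [mul_inv]
    refine add_le_add_left ?_ _
    calc (sqBall S t : ℝ) * u ^ n * (y ^ j * p) ^ 2
        = sqBall S t * u ^ n * ((y ^ j) ^ 2 * p ^ 2) := by ring
      _ ≤ sqBall S t * u ^ n * (u ^ j * p ^ 2) := by gcongr
      _ = _ := by rw [pow_add]; ring
  rw [tsum_eq_sum (s := F) fun x hx => by rw [hF' x hx, mul_zero]]
  calc _ ≤ _ := Finset.sum_le_sum fun x _ => hpt x
    _ = √t ^ j * (sqBall S t *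
          (∑ x ∈ F, (1 + (wordLength S x : ℝ) ^ 2 / t) ^ (j + n) * walkProb S t x ^ 2) +
        (sqBall S t : ℝ)⁻¹ * ∑ x ∈ F, ((1 + (wordLength S x : ℝ) ^ 2 / t) ^ n)⁻¹) := by
      rw [← Finset.mul_sum, Finset.sum_add_distrib, Finset.mul_sum, Finset.mul_sum]
    _ ≤ √t ^ j * (sqBall S t *
          (∑' x, (1 + (wordLength S x : ℝ) ^ 2 / t) ^ (j + n) * walkProb S t x ^ 2) +
        (sqBall S t : ℝ)⁻¹ * (B₂ * sqBall S t)) := by gcongr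
    _ = √t ^ j * (sqBall S t *
          (∑' x, (1 + (wordLength S x : ℝ) ^ 2 / t) ^ (j + n) * walkProb S t x ^ 2) + B₂) := by
      field_simp
    _ ≤ √t ^ j * (B₁ + B₂ + 1) := mul_le_mul_of_nonneg_left (by linarith) (by positivity)
    _ = _ := mul_comm _ _

end WalkMoments

section TwoSided

variable {S : Finset G} (hS : IsSymmGen S)
include hS

theorem IsSymmGen.exists_le_even_return (hG : Group.IsNilpotent G) :
    ∃ c : ℝ, 0 < c ∧ ∀ k, c ≤ walkProb S (2 * k) 1 * sqBall S k := by
  classical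
  obtain ⟨C, hC, hmom⟩ := hS.exists_moment_le hG 2
  obtain ⟨A, hA⟩ := exists_nat_gt (2 * C)
  obtain ⟨K, hK⟩ := hS.exists_sqBall_doubling hG A
  refine ⟨1 / (4 * (K + 1)), by positivity, fun k => ?_⟩
  have hKpos : (0 : ℝ) < 4 * (K + 1) := by positivity
  have hV : (0 : ℝ) < sqBall S k := by exact_mod_cast hS.sqBall_pos k
  rw [div_le_iff₀ hKpos]
  rcases Nat.eq_zero_or_pos k with rfl | hk
  · have h1 : (1 : ℝ) ≤ sqBall S 0 := by exact_mod_cast hS.sqBall_pos 0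
    rw [mul_zero, walkProb_zero, if_pos rfl, one_mul]
    nlinarith
  have hk0 : (0 : ℝ) < k := by exact_mod_cast hk
  have hA0 : (0 : ℝ) < A := by linarith
  have hmom := hmom k hk
  rw [Real.sq_sqrt hk0.le] at hmom
  set F := hS.sqBallFinset (A * k)
  have hs2 := hS.summable_mul_walkProb (fun x => (wordLength S x : ℝ) ^ 2) k
  have hmarkov : 1 ≤ ∑ x ∈ F, walkProb S k x + C / A := by
    have hpt : ∀ x, walkProb S k x ≤ (if x ∈ F then walkProb S k x else 0) +
        1 / (A * k) * ((wordLength S x : ℝ) ^ 2 * walkProb S k x) := by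
      intro x
      have hp := walkProb_nonneg (S := S) k x
      split_ifs with hx
      · have : 0 ≤ 1 / ((A : ℝ) * k) * ((wordLength S x : ℝ) ^ 2 * walkProb S k x) := by
          positivity
        linarith
      · have h1 : ((A * k : ℕ) : ℝ) ≤ (wordLength S x ^ 2 : ℕ) := by
          have := not_le.mp fun h => hx (hS.mem_sqBallFinset.mpr h)
          exact_mod_cast this.le
        push_cast at h1
        rw [zero_add, ← mul_assoc, one_div, ← div_eq_inv_mul]
        refine le_mul_of_one_le_left hp ?_
        rwa [one_le_div (by positivity)]
    have hs1 : Summable fun x => if x ∈ F then walkProb S k x else 0 :=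
      summable_of_support (hS.finite_support_walkProb k) fun x hx => by simp [hx]
    have h2 := (hS.summable_walkProb k).tsum_le_tsum hpt (hs1.add (hs2.mul_left _))
    rw [hS.tsum_walkProb, hs1.tsum_add (hs2.mul_left _), tsum_mul_left,
      tsum_eq_sum (s := F) fun x hx => if_neg hx,
      Finset.sum_congr rfl fun x hx => if_pos hx] at h2
    refine h2.trans ?_
    have h3 : 1 / ((A : ℝ) * k) * ∑' x, (wordLength S x : ℝ) ^ 2 * walkProb S k x ≤ C / A := by
      calc _ ≤ 1 / ((A : ℝ) * k) * (C * k) := by gcongr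
        _ = C / A := by field_simp
    linarith
  have hCA : C / A ≤ 1 / 2 := by
    rw [div_le_iff₀ hA0]
    linarith
  have hhalf : 1 / 2 ≤ ∑ x ∈ F, walkProb S k x := by linarith
  have hcs : (∑ x ∈ F, walkProb S k x) ^ 2 ≤ sqBall S (A * k) * walkProb S (2 * k) 1 := by
    refine sq_sum_le_card_mul_sum_sq.trans ?_
    rw [hS.card_sqBallFinset]
    refine mul_le_mul_of_nonneg_left ?_ (Nat.cast_nonneg _)
    rw [← hS.tsum_walkProb_sq]
    have := hS.summable_mul_walkProb_sq (fun _ => 1) k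
    simp only [one_mul] at this
    exact this.sum_le_tsum _ fun _ _ => sq_nonneg _
  have hVK : (sqBall S (A * k) : ℝ) ≤ K * sqBall S k := by
    exact_mod_cast (hS.sqBall_mono (Nat.mul_le_mul_left A k.le_succ)).trans (hK k)
  have hb := walkProb_nonneg (S := S) (2 * k) 1
  have h4 : (1 / 2 : ℝ) ^ 2 ≤ (∑ x ∈ F, walkProb S k x) ^ 2 := by gcongr
  have h5 : (sqBall S (A * k) : ℝ) * walkProb S (2 * k) 1 ≤
      (K + 1) * sqBall S k * walkProb S (2 * k) 1 := by
    refine mul_le_mul_of_nonneg_right (hVK.trans ?_) hb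
    linarith
  linarith

theorem IsSymmGen.exists_le_return (hG : Group.IsNilpotent G) :
    ∃ c : ℝ, 0 < c ∧ ∀ n, c ≤ walkProb S n 1 * sqBall S n := by
  obtain ⟨c, hc, h⟩ := hS.exists_le_even_return hG
  refine ⟨c / numLetters S, div_pos hc (numLetters_pos S), fun n => ?_⟩
  have hq := numLetters_pos S
  rw [div_le_iff₀ hq]
  rcases Nat.even_or_odd' n with ⟨k, rfl | rfl⟩
  · have h1 : (sqBall S k : ℝ) ≤ sqBall S (2 * k) := by
      exact_mod_cast hS.sqBall_mono (by lia)
    have hb := walkProb_nonneg (S := S) (2 * k) 1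
    calc c ≤ _ := h k
      _ ≤ walkProb S (2 * k) 1 * sqBall S (2 * k) := by gcongr
      _ ≤ _ := le_mul_of_one_le_right (by positivity) (one_le_numLetters S)
  · have h1 : (sqBall S k : ℝ) ≤ sqBall S (2 * k + 1) := by
      exact_mod_cast hS.sqBall_mono (by lia)
    have h2 := le_avg (S := S) (walkProb_nonneg (S := S) (2 * k)) 1 none
    rw [← walkProb_succ] at h2
    have h3 : (1 : G) * lazyVal (none : Option {x // x ∈ S}) = 1 := one_mul _
    rw [h3] at h2
    have hb := walkProb_nonneg (S := S) (2 * k) 1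
    have hb' := walkProb_nonneg (S := S) (2 * k + 1) 1
    calc c ≤ _ := h k
      _ ≤ numLetters S * walkProb S (2 * k + 1) 1 * sqBall S (2 * k + 1) := by gcongr
      _ = _ := by ring

theorem IsSymmGen.exists_walkProb_mul_le (hG : Group.IsNilpotent G) :
    ∃ C : ℝ, 0 < C ∧ ∀ n g, walkProb S n g * sqBall S n ≤ C := by
  obtain ⟨C, hC, h⟩ := hS.exists_return_le hG
  obtain ⟨K, hK⟩ := hS.exists_sqBall_doubling hG 2
  refine ⟨(K + 1) * C, by positivity, fun n g => ?_⟩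
  have h1 : (sqBall S n : ℝ) ≤ K * sqBall S (n / 2) := by
    exact_mod_cast (hS.sqBall_mono (by lia : n ≤ 2 * (n / 2 + 1))).trans (hK _)
  have h2 := h (n / 2)
  have hb := walkProb_nonneg (S := S) (2 * (n / 2)) 1
  calc _ ≤ walkProb S (2 * (n / 2)) 1 * (K * sqBall S (n / 2)) := by
        gcongr
        exact hS.walkProb_le n g
    _ = K * (walkProb S (2 * (n / 2)) 1 * sqBall S (n / 2)) := by ring
    _ ≤ (K + 1) * C := by gcongr; linarith

theorem IsSymmGen.exists_walkProb_le_return (hG : Group.IsNilpotent G) :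
    ∃ C : ℝ, 0 < C ∧ ∀ m n g, n ≤ 2 * (m + 1) → walkProb S m g ≤ C * walkProb S n 1 := by
  obtain ⟨C, hC, hle⟩ := hS.exists_walkProb_mul_le hG
  obtain ⟨c, hc, hge⟩ := hS.exists_le_return hG
  obtain ⟨K, hK⟩ := hS.exists_sqBall_doubling hG 2
  refine ⟨C / c * (K + 1), by positivity, fun m n g hmn => ?_⟩
  have hV : (0 : ℝ) < sqBall S m := by exact_mod_cast hS.sqBall_pos m
  have h1 : (sqBall S n : ℝ) ≤ K * sqBall S m := by
    exact_mod_cast (hS.sqBall_mono hmn).trans (hK m)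
  have hb := walkProb_nonneg (S := S) n 1
  refine le_of_mul_le_mul_right ?_ hV
  calc _ ≤ C := hle m g
    _ = C / c * c := by field_simp
    _ ≤ C / c * (walkProb S n 1 * ((K + 1) * sqBall S m)) := by
      refine mul_le_mul_of_nonneg_left ((hge n).trans ?_) (by positivity)
      gcongr
      linarith
    _ = _ := by ring

theorem IsSymmGen.exists_wordLength_eq [Infinite G] (n : ℕ) : ∃ g, wordLength S g = n := by
  obtain ⟨g, hg⟩ := (hS.finite_ball n).exists_notMem
  rw [Set.mem_ofPred_eq, not_le] at hg
  obtain ⟨l, hl, hlS, rfl⟩ := hS.exists_list_length_eq g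
  refine ⟨(l.take n).prod, ?_⟩
  have h1 : wordLength S (l.take n).prod ≤ n :=
    (wordLength_prod_le fun x hx => hlS x (List.mem_of_mem_take hx)).trans
      (List.length_take_le _ _)
  have h2 : wordLength S (l.drop n).prod ≤ l.length - n :=
    (wordLength_prod_le fun x hx => hlS x (List.mem_of_mem_drop hx)).trans_eq List.length_drop
  have h3 := hS.wordLength_mul_le (l.take n).prod (l.drop n).prod
  rw [List.prod_take_mul_prod_drop] at h3
  omega

theorem IsSymmGen.mul_ballCard_le [Infinite G] (k r : ℕ) :
    k * ballCard S r ≤ ballCard S (k * (2 * r + 1)) := by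
  choose x hx using hS.exists_wordLength_eq
  have hinj : Set.InjOn (fun p : ℕ × G => x (p.1 * (2 * r + 1)) * p.2)
      ((Set.Iio k) ×ˢ {g | wordLength S g ≤ r}) := by
    rintro ⟨i, b⟩ ⟨-, hb⟩ ⟨j, b'⟩ ⟨-, hb'⟩ h
    simp only [Set.mem_ofPred_eq] at hb hb' h
    have key : ∀ i j b b', wordLength S b ≤ r → wordLength S b' ≤ r →
        x (i * (2 * r + 1)) * b = x (j * (2 * r + 1)) * b' → i ≤ j := by
      intro i j b b' hb hb' h
      have h1 : x (i * (2 * r + 1)) = x (j * (2 * r + 1)) * (b' * b⁻¹) := by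
        rw [← mul_assoc, ← h, mul_inv_cancel_right]
      have h2 := hS.wordLength_mul_le (x (j * (2 * r + 1))) (b' * b⁻¹)
      have h3 := hS.wordLength_mul_le b' b⁻¹
      rw [← h1, hx, hx] at h2
      rw [hS.wordLength_inv] at h3
      by_contra! hij
      have h4 : (j + 1) * (2 * r + 1) ≤ i * (2 * r + 1) := Nat.mul_le_mul_right _ hij
      rw [add_mul, one_mul] at h4
      omega
    obtain rfl : i = j := le_antisymm (key i j b b' hb hb' h) (key j i b' b hb' hb h.symm)
    rw [mul_left_cancel h]
  have hmaps : Set.MapsTo (fun p : ℕ × G => x (p.1 * (2 * r + 1)) * p.2)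
      ((Set.Iio k) ×ˢ {g | wordLength S g ≤ r}) {g | wordLength S g ≤ k * (2 * r + 1)} := by
    rintro ⟨i, b⟩ ⟨hi, hb⟩
    simp only [Set.mem_Iio, Set.mem_ofPred_eq] at hi hb ⊢
    have h1 := hS.wordLength_mul_le (x (i * (2 * r + 1))) b
    rw [hx] at h1
    have h2 : (i + 1) * (2 * r + 1) ≤ k * (2 * r + 1) := Nat.mul_le_mul_right _ hi
    rw [add_mul, one_mul] at h2
    omega
  have h := Set.ncard_le_ncard_of_injOn _ hmaps hinj (hS.finite_ball _)
  rw [Set.ncard_prod] at h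
  have hk : (Set.Iio k).ncard = k := by
    rw [← Finset.coe_Iio, Set.ncard_coe_finset, Nat.card_Iio]
  rwa [hk] at h

theorem IsSymmGen.mul_sqBall_le [Infinite G] (k : ℕ) {s : ℕ} (hs : 1 ≤ s) :
    k * sqBall S s ≤ sqBall S (9 * k ^ 2 * s) := by
  have h1 : 1 ≤ Nat.sqrt s := Nat.le_sqrt'.mpr (by simpa using hs)
  refine (hS.mul_ballCard_le k _).trans (hS.ballCard_mono ?_)
  rw [Nat.le_sqrt']
  calc _ ≤ (k * (3 * Nat.sqrt s)) ^ 2 := by gcongr; omega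
    _ = 9 * k ^ 2 * Nat.sqrt s ^ 2 := by ring
    _ ≤ _ := by gcongr; exact Nat.sqrt_le' s

end TwoSided

section Bridge

variable {S : Finset G} (hS : IsSymmGen S)
include hS

theorem IsSymmGen.tsum_bridge {n t : ℕ} (h : t ≤ n) :
    ∑' x, walkProb S (n - t) x * walkProb S t x = walkProb S n 1 := by
  have := hS.tsum_walkProb_mul_walkProb 1 (n - t) t
  simpa only [inv_one, one_mul, Nat.sub_add_cancel h] using this

theorem IsSymmGen.exists_bridge_moment_le (hG : Group.IsNilpotent G) (m : ℕ) :
    ∃ c : ℝ, 0 < c ∧ ∀ n t : ℕ, 1 ≤ t → 2 * t ≤ n →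
      ∑' x, (wordLength S x : ℝ) ^ m * walkProb S (n - t) x * walkProb S t x ≤
        c * √t ^ m * walkProb S n 1 := by
  obtain ⟨C, hC, hcomp⟩ := hS.exists_walkProb_le_return hG
  obtain ⟨D, hD, hmom⟩ := hS.exists_moment_le hG m
  refine ⟨C * D, by positivity, fun n t ht htn => ?_⟩
  have hp := walkProb_nonneg (S := S) n 1
  calc _ ≤ ∑' x, C * walkProb S n 1 * ((wordLength S x : ℝ) ^ m * walkProb S t x) := by
        refine (hS.summable_mul_walkProb _ t).tsum_le_tsum (fun x => ?_)
          ((hS.summable_mul_walkProb _ t).mul_left _)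
        have hpt := walkProb_nonneg (S := S) t x
        have h1 := hcomp (n - t) n x (by lia)
        calc _ ≤ (wordLength S x : ℝ) ^ m * (C * walkProb S n 1) * walkProb S t x := by gcongr
          _ = _ := by ring
    _ = C * walkProb S n 1 * ∑' x, (wordLength S x : ℝ) ^ m * walkProb S t x := tsum_mul_left
    _ ≤ C * walkProb S n 1 * (D * √t ^ m) := by
      have := hmom t ht
      gcongr
    _ = _ := by ring

theorem IsSymmGen.exists_le_bridge_moment_of_le (hG : Group.IsNilpotent G) [Infinite G]
    (m A : ℕ) : ∃ c : ℝ, 0 < c ∧ ∀ n t : ℕ, 1 ≤ t → t ≤ A → 2 * t ≤ n →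
      c * walkProb S n 1 ≤
        ∑' x, (wordLength S x : ℝ) ^ m * walkProb S (n - t) x * walkProb S t x := by
  obtain ⟨C, hC, hcomp⟩ := hS.exists_walkProb_le_return hG
  obtain ⟨b, hb, hret⟩ := hS.exists_le_return hG
  obtain ⟨s, hs⟩ := hS.exists_wordLength_eq 1
  have hsS : s ∈ S := by
    obtain ⟨l, hl, hlS, rfl⟩ := hS.exists_list_length_eq s
    rw [hs, List.length_eq_one_iff] at hl
    obtain ⟨a, rfl⟩ := hl
    simpa using hlS a (by simp)
  have hq := numLetters_pos S
  have hVA : (0 : ℝ) < sqBall S A := by exact_mod_cast hS.sqBall_pos A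
  have hstep : ∀ k, walkProb S k 1 ≤ numLetters S * walkProb S (k + 1) s := by
    intro k
    have h1 := le_avg (S := S) (walkProb_nonneg (S := S) k) s (some ⟨s⁻¹, hS.inv_mem s hsS⟩)
    rw [← walkProb_succ] at h1
    have h2 : s * lazyVal (some (⟨s⁻¹, hS.inv_mem s hsS⟩ : {x // x ∈ S})) = 1 :=
      mul_inv_cancel s
    rwa [h2] at h1
  refine ⟨1 / (numLetters S * C) * (b / (numLetters S * sqBall S A)), by positivity,
    fun n t ht htA htn => ?_⟩
  obtain ⟨t, rfl⟩ := Nat.exists_eq_add_of_le' ht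
  obtain ⟨k, hk⟩ : ∃ k, n - (t + 1) = k + 1 := ⟨n - (t + 1) - 1, by lia⟩
  have h1 : 1 / (numLetters S * C) * walkProb S n 1 ≤ walkProb S (n - (t + 1)) s := by
    rw [one_div, ← div_eq_inv_mul, div_le_iff₀ (by positivity), hk]
    have h2 := hcomp n k 1 (by lia)
    calc _ ≤ C * walkProb S k 1 := h2
      _ ≤ C * (numLetters S * walkProb S (k + 1) s) := by
        have := hstep k
        gcongr
      _ = _ := by ring
  have h2 : b / (numLetters S * sqBall S A) ≤ walkProb S (t + 1) s := by
    rw [div_le_iff₀ (by positivity)]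
    have h3 : (sqBall S t : ℝ) ≤ sqBall S A := by exact_mod_cast hS.sqBall_mono (by lia)
    have h4 := walkProb_nonneg (S := S) t 1
    have h5 := walkProb_nonneg (S := S) (t + 1) s
    have h6 := hstep t
    calc b ≤ _ := hret t
      _ ≤ numLetters S * walkProb S (t + 1) s * sqBall S A := by gcongr
      _ = _ := by ring
  have h3 : walkProb S (n - (t + 1)) s * walkProb S (t + 1) s ≤
      ∑' x, (wordLength S x : ℝ) ^ m * walkProb S (n - (t + 1)) x * walkProb S (t + 1) x := by
    have := (hS.summable_mul_walkProb (fun x => (wordLength S x : ℝ) ^ m *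
      walkProb S (n - (t + 1)) x) (t + 1)).le_tsum s fun x _ =>
        mul_nonneg (mul_nonneg (by positivity) (walkProb_nonneg _ _)) (walkProb_nonneg _ _)
    simpa [hs] using this
  refine le_trans ?_ h3
  have h4 := walkProb_nonneg (S := S) (n - (t + 1)) s
  calc _ = 1 / (numLetters S * C) * walkProb S n 1 * (b / (numLetters S * sqBall S A)) := by ring
    _ ≤ _ := by gcongr

theorem IsSymmGen.exists_le_bridge_moment (hG : Group.IsNilpotent G) [Infinite G] (m : ℕ) :
    ∃ c : ℝ, 0 < c ∧ ∀ n t : ℕ, 1 ≤ t → 2 * t ≤ n →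
      c * √t ^ m * walkProb S n 1 ≤
        ∑' x, (wordLength S x : ℝ) ^ m * walkProb S (n - t) x * walkProb S t x := by
  classical
  obtain ⟨C, hC, hcomp⟩ := hS.exists_walkProb_le_return hG
  obtain ⟨D, hD, hle⟩ := hS.exists_walkProb_mul_le hG
  obtain ⟨k, hk⟩ := exists_nat_gt (2 * C * D)
  have hk0 : (0 : ℝ) < k := lt_trans (by positivity) hk
  set A := 9 * k ^ 2 with hA_def
  have hkn : 0 < k := by exact_mod_cast hk0
  have hA : 0 < A := by positivity
  have hAR : (0 : ℝ) < A := by exact_mod_cast hA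
  obtain ⟨c, hc, hsmall⟩ := hS.exists_le_bridge_moment_of_le hG m A
  refine ⟨min (c / √A ^ m) (1 / 2 / √A ^ m), by positivity, fun n t ht htn => ?_⟩
  have hpn := walkProb_nonneg (S := S) n 1
  rcases le_or_gt t A with htA | htA
  · refine le_trans ?_ (hsmall n t ht htA htn)
    gcongr
    calc _ ≤ c / √A ^ m * √A ^ m := by
          gcongr
          exact min_le_left _ _
      _ = c := by field_simp
  · set s := t / A
    have hs : 1 ≤ s := (Nat.one_le_div_iff hA).mpr htA.le
    have hst : A * s ≤ t := Nat.mul_div_le t A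
    have hVt : (0 : ℝ) < sqBall S t := by exact_mod_cast hS.sqBall_pos t
    have hVs : (k : ℝ) * sqBall S s ≤ sqBall S t := by
      exact_mod_cast (hS.mul_sqBall_le k hs).trans (hS.sqBall_mono hst)
    set F := hS.sqBallFinset s
    have hball : ∑ x ∈ F, walkProb S (n - t) x * walkProb S t x ≤ 1 / 2 * walkProb S n 1 := by
      have hpt : ∀ x ∈ F, walkProb S (n - t) x * walkProb S t x ≤
          C * walkProb S n 1 * (D / sqBall S t) := by
        intro x _
        have h1 := hcomp (n - t) n x (by lia)
        have h2 : walkProb S t x ≤ D / sqBall S t := (le_div_iff₀ hVt).mpr (hle t x)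
        have h3 := walkProb_nonneg (S := S) t x
        gcongr
      refine (Finset.sum_le_sum hpt).trans ?_
      rw [Finset.sum_const, hS.card_sqBallFinset, nsmul_eq_mul]
      have h4 : (sqBall S s : ℝ) * (C * D / sqBall S t) ≤ 1 / 2 := by
        rw [← mul_div_assoc, div_le_iff₀ hVt]
        have h5 : (0 : ℝ) ≤ sqBall S s := Nat.cast_nonneg _
        nlinarith
      calc _ = (sqBall S s : ℝ) * (C * D / sqBall S t) * walkProb S n 1 := by ring
        _ ≤ _ := by gcongr
    set L : ℝ := √t ^ m / √A ^ m with hL_def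
    have hL : 0 ≤ L := by positivity
    have hpt : ∀ x, L * (walkProb S (n - t) x * walkProb S t x) ≤
        (wordLength S x : ℝ) ^ m * walkProb S (n - t) x * walkProb S t x +
          L * (if x ∈ F then walkProb S (n - t) x * walkProb S t x else 0) := by
      intro x
      have hp : 0 ≤ walkProb S (n - t) x * walkProb S t x :=
        mul_nonneg (walkProb_nonneg _ _) (walkProb_nonneg _ _)
      rw [mul_assoc]
      split_ifs with hx
      · have : 0 ≤ (wordLength S x : ℝ) ^ m * (walkProb S (n - t) x * walkProb S t x) := by
          positivity
        linarith
      · rw [mul_zero, add_zero]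
        refine mul_le_mul_of_nonneg_right ?_ hp
        rw [hL_def, ← div_pow, ← Real.sqrt_div (Nat.cast_nonneg _)]
        refine pow_le_pow_left₀ (Real.sqrt_nonneg _) ?_ m
        refine Real.sqrt_le_left (Nat.cast_nonneg _) |>.mpr ?_
        have h1 := not_le.mp fun h => hx (hS.mem_sqBallFinset.mpr h)
        rw [div_le_iff₀ hAR]
        have h2 : t ≤ wordLength S x ^ 2 * A := by
          have := Nat.lt_mul_div_succ t hA
          calc t ≤ A * (s + 1) := this.le
            _ ≤ A * wordLength S x ^ 2 := Nat.mul_le_mul_left _ h1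
            _ = _ := mul_comm _ _
        exact_mod_cast h2
    have hsum1 := hS.summable_mul_walkProb (walkProb S (n - t)) t
    have hsum2 := hS.summable_mul_walkProb
      (fun x => (wordLength S x : ℝ) ^ m * walkProb S (n - t) x) t
    have hsum3 : Summable fun x =>
        if x ∈ F then walkProb S (n - t) x * walkProb S t x else 0 :=
      summable_of_support (hS.finite_support_walkProb t) fun x hx => by simp [hx]
    have h := (hsum1.mul_left L).tsum_le_tsum hpt (hsum2.add (hsum3.mul_left L))
    rw [tsum_mul_left, hS.tsum_bridge (by lia), hsum2.tsum_add (hsum3.mul_left L), tsum_mul_left,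
      tsum_eq_sum (s := F) fun x hx => if_neg hx,
      Finset.sum_congr rfl fun x hx => if_pos hx] at h
    have h6 := mul_le_mul_of_nonneg_left hball hL
    have h7 : min (c / √A ^ m) (1 / 2 / √A ^ m) * √t ^ m * walkProb S n 1 ≤
        1 / 2 / √A ^ m * √t ^ m * walkProb S n 1 := by
      gcongr
      exact min_le_right _ _
    have h8 : 1 / 2 / √A ^ m * √t ^ m * walkProb S n 1 = 1 / 2 * (L * walkProb S n 1) := by
      rw [hL_def]; ring
    linarith

end Bridge

section Words

variable {S : Finset G}

theorem walkPos_snoc_of_le {n t : ℕ} (ht : t ≤ n) (w : Fin n → Option {x // x ∈ S})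
    (a : Option {x // x ∈ S}) :
    walkPos (Fin.snoc w a : Fin (n + 1) → Option {x // x ∈ S}) t = walkPos w t := by
  rw [walkPos, walkPos, List.ofFn_succ']
  simp only [Fin.snoc_castSucc, Fin.snoc_last, List.concat_eq_append]
  rw [List.take_append_of_le_length (by simpa using ht)]

theorem walkPos_snoc_last {n : ℕ} (w : Fin n → Option {x // x ∈ S}) (a : Option {x // x ∈ S}) :
    walkPos (Fin.snoc w a : Fin (n + 1) → Option {x // x ∈ S}) (n + 1) =
      walkPos w n * lazyVal a := by
  rw [walkPos, walkPos, List.ofFn_succ']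
  simp only [Fin.snoc_castSucc, Fin.snoc_last, List.concat_eq_append]
  rw [List.take_of_length_le (by simp), List.take_of_length_le (by simp)]
  simp

omit [Group G] in
theorem sum_words_succ {n : ℕ} (f : (Fin (n + 1) → Option {x // x ∈ S}) → ℝ) :
    ∑ w, f w = ∑ w : Fin n → Option {x // x ∈ S}, ∑ a, f (Fin.snoc w a) := by
  rw [← Fintype.sum_prod_type', ← (Fin.snocEquiv fun _ => Option {x // x ∈ S}).sum_comp,
    ← (Equiv.prodComm _ _).sum_comp]
  rfl

theorem sum_letters_eq_avg (f : G → ℝ) (x : G) :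
    ∑ a : Option {x // x ∈ S}, f (x * lazyVal a) = numLetters S * avg S f x := by
  rw [avg, mul_div_cancel₀ _ (numLetters_pos S).ne']

theorem sum_words_walkPos (n : ℕ) (f : G → ℝ) :
    ∑ w : Fin n → Option {x // x ∈ S}, f (walkPos w n) =
      numLetters S ^ n * (avg S)^[n] f 1 := by
  induction n generalizing f with
  | zero => simp [walkPos]
  | succ n ih =>
    rw [sum_words_succ]
    simp only [walkPos_snoc_last, sum_letters_eq_avg]
    rw [← Finset.mul_sum, ih, Function.iterate_succ_apply, pow_succ']
    ring

theorem sum_words_walkPos_mul {t n : ℕ} (htn : t ≤ n) (f g : G → ℝ) :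
    ∑ w : Fin n → Option {x // x ∈ S}, f (walkPos w t) * g (walkPos w n) =
      numLetters S ^ n * (avg S)^[t] (fun x => f x * (avg S)^[n - t] g x) 1 := by
  induction n, htn using Nat.le_induction generalizing g with
  | base => simpa using sum_words_walkPos t fun x => f x * g x
  | succ n htn ih =>
    rw [sum_words_succ]
    simp only [walkPos_snoc_last, walkPos_snoc_of_le htn, ← Finset.mul_sum, sum_letters_eq_avg,
      mul_left_comm _ (numLetters S)]
    rw [ih, Nat.sub_add_comm htn, Function.iterate_succ, pow_succ']
    simp only [Function.comp_apply]
    ring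

open scoped Classical in
theorem sum_closedWalks (n : ℕ) (f : (Fin n → Option {x // x ∈ S}) → ℝ) :
    ∑ w ∈ closedWalks S n, f w = ∑ w, f w * if walkPos w n = 1 then 1 else 0 := by
  rw [closedWalks, Finset.sum_filter]
  exact Finset.sum_congr rfl fun w _ => by simp

theorem IsSymmGen.sum_closedWalks_walkPos (hS : IsSymmGen S) {t n : ℕ} (htn : t ≤ n)
    (f : G → ℝ) : ∑ w ∈ closedWalks S n, f (walkPos w t) =
      numLetters S ^ n * ∑' x, f x * walkProb S (n - t) x * walkProb S t x := by
  classical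
  rw [sum_closedWalks, hS.tsum_mul_walkProb]
  exact sum_words_walkPos_mul htn f fun x => if x = 1 then 1 else 0

theorem IsSymmGen.card_closedWalks (hS : IsSymmGen S) (n : ℕ) :
    ((closedWalks S n).card : ℝ) = numLetters S ^ n * walkProb S n 1 := by
  have h := hS.sum_closedWalks_walkPos le_rfl (fun _ => 1) (n := n)
  simp only [one_mul, hS.tsum_bridge le_rfl] at h
  rw [← h, Finset.sum_const, nsmul_eq_mul, mul_one]

end Words

theorem moment_theta_bound (G : Type*) [Group G] (S : Finset G)
    (hgen : Subgroup.closure (S : Set G) = ⊤)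
    (hsymm : ∀ x ∈ S, x⁻¹ ∈ S)
    (hnilp : Group.IsNilpotent G)
    (hinf : Infinite G)
    (m : ℕ) (hm : 1 ≤ m) :
    ∃ c' c : ℝ, 0 < c' ∧ 0 < c ∧ ∀ n : ℕ, 0 < n → ∀ t : ℕ, 1 ≤ t → 2 * t ≤ n →
      c' * (t : ℝ) ^ ((m : ℝ) / 2) ≤
        (∑ w ∈ closedWalks S n, ((wordLength S (walkPos w t) : ℝ)) ^ m) /
          ((closedWalks S n).card : ℝ) ∧
      (∑ w ∈ closedWalks S n, ((wordLength S (walkPos w t) : ℝ)) ^ m) /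
          ((closedWalks S n).card : ℝ)
        ≤ c * (t : ℝ) ^ ((m : ℝ) / 2) := by
  have hS : IsSymmGen S := ⟨hgen, hsymm⟩
  obtain ⟨c', hc', hlower⟩ := hS.exists_le_bridge_moment hnilp m
  obtain ⟨c, hc, hupper⟩ := hS.exists_bridge_moment_le hnilp m
  obtain ⟨b, hb, hret⟩ := hS.exists_le_return hnilp
  refine ⟨c', c, hc', hc, fun n _ t ht htn => ?_⟩
  have hq : 0 < numLetters S ^ n := pow_pos (numLetters_pos S) n
  have hp : 0 < walkProb S n 1 :=
    pos_of_mul_pos_left (hb.trans_le (hret n)) (Nat.cast_nonneg _)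
  have hsqrt : (t : ℝ) ^ ((m : ℝ) / 2) = √t ^ m := by
    rw [Real.sqrt_eq_rpow, ← Real.rpow_mul_natCast (Nat.cast_nonneg t)]
    congr 1
    ring
  rw [hS.sum_closedWalks_walkPos (by lia : t ≤ n) fun x => (wordLength S x : ℝ) ^ m,
    hS.card_closedWalks, mul_div_mul_left _ _ hq.ne', hsqrt, le_div_iff₀ hp, div_le_iff₀ hp]
  exact ⟨hlower n t ht htn, hupper n t ht htn⟩

end AvgDehnPaper
end

section
/- Let D ≥ 1 be an integer, (b_i) a real sequence with partial sums B_j = Σ_{i≤j} b_i satisfying z·j^D ≤ B_j ≤ Z·j^D for all j ≥ 1 (with 0 < z ≤ Z), and let (a_i) be a nonincreasing positive sequence. Then there exist constants z', Z' > 0 depending only on z, Z, D such that for all 1 ≤ n ≤ m: Σ_{i=n}^m z'·a_i·i^{D−1} − a_{n−1}(Z−z)(n−1)^D ≤ Σ_{i=n}^m a_i b_i ≤ Σ_{i=n}^m Z'·a_i·i^{D−1} + a_{n−1}(Z−z)(n−1)^D. -/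
/-!
Statement 13: Let `D ≥ 1` be an integer and `0 < z ≤ Z`.  Then there exist constants
`z', Z' > 0` depending only on `z, Z, D` such that: whenever `(b_i)` is a real sequence
whose partial sums `B_j = Σ_{1 ≤ i ≤ j} b_i` satisfy `z·j^D ≤ B_j ≤ Z·j^D` for all
`j ≥ 1`, and `(a_i)` is a nonincreasing positive sequence, then for all `1 ≤ n ≤ m`:
`Σ_{i=n}^m z'·a_i·i^{D−1} − a_{n−1}(Z−z)(n−1)^D ≤ Σ_{i=n}^m a_i b_i
  ≤ Σ_{i=n}^m Z'·a_i·i^{D−1} + a_{n−1}(Z−z)(n−1)^D`.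
-/

theorem mul_sub_mul_le_sum_mul_sub {a C : ℕ → ℝ} (ha : Antitone a) (hC : ∀ j, 0 ≤ C j)
    {k m : ℕ} (hkm : k ≤ m) :
    a m * C m - a k * C k ≤ ∑ i ∈ Finset.Icc (k + 1) m, a i * (C i - C (i - 1)) := by
  induction m, hkm using Nat.le_induction with
  | base => simp
  | succ m hkm ih =>
    rw [Finset.sum_Icc_succ_top (by omega), Nat.add_sub_cancel]
    have := mul_le_mul_of_nonneg_right (ha m.le_succ) (hC m)
    simp only [Nat.succ_eq_add_one] at this
    linarith

/-- If the partial sums of `b` are dominated by those of `d`, then for nonincreasing nonnegative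
weights the weighted sums compare, up to a boundary term. -/
theorem sum_mul_le_sum_mul_add {a b d : ℕ → ℝ} (ha : Antitone a) (ha0 : ∀ i, 0 ≤ a i)
    (h : ∀ j, ∑ i ∈ Finset.Icc 1 j, b i ≤ ∑ i ∈ Finset.Icc 1 j, d i) {k m : ℕ} (hkm : k ≤ m) :
    ∑ i ∈ Finset.Icc (k + 1) m, a i * b i ≤ ∑ i ∈ Finset.Icc (k + 1) m, a i * d i +
      a k * (∑ i ∈ Finset.Icc 1 k, d i - ∑ i ∈ Finset.Icc 1 k, b i) := by
  have key := mul_sub_mul_le_sum_mul_sub ha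
    (C := fun j => ∑ i ∈ Finset.Icc 1 j, d i - ∑ i ∈ Finset.Icc 1 j, b i)
    (fun j => sub_nonneg.2 (h j)) hkm
  have hm := mul_nonneg (ha0 m) (sub_nonneg.2 (h m))
  have hsum : ∑ i ∈ Finset.Icc (k + 1) m, a i *
      ((∑ l ∈ Finset.Icc 1 i, d l - ∑ l ∈ Finset.Icc 1 i, b l) -
        (∑ l ∈ Finset.Icc 1 (i - 1), d l - ∑ l ∈ Finset.Icc 1 (i - 1), b l)) =
      ∑ i ∈ Finset.Icc (k + 1) m, a i * d i - ∑ i ∈ Finset.Icc (k + 1) m, a i * b i := by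
    rw [← Finset.sum_sub_distrib]
    refine Finset.sum_congr rfl fun i hi => ?_
    obtain ⟨j, rfl⟩ : ∃ j, i = j + 1 := ⟨i - 1, by have := Finset.mem_Icc.1 hi; omega⟩
    rw [Nat.add_sub_cancel, Finset.sum_Icc_succ_top (by omega), Finset.sum_Icc_succ_top (by omega)]
    ring
  simp only [hsum] at key
  linarith

theorem pow_le_add_one_pow_succ_sub {x : ℝ} (hx : 0 ≤ x) (d : ℕ) :
    (x + 1) ^ d ≤ (x + 1) ^ (d + 1) - x ^ (d + 1) := by
  have h : x ^ d ≤ (x + 1) ^ d := by gcongr; linarith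
  rw [pow_succ, pow_succ]
  nlinarith [mul_le_mul_of_nonneg_right h hx]

theorem add_one_pow_succ_sub_le {x : ℝ} (hx : 0 ≤ x) (d : ℕ) :
    (x + 1) ^ (d + 1) - x ^ (d + 1) ≤ (d + 1 : ℕ) * (x + 1) ^ d := by
  induction d with
  | zero => simp
  | succ d ih =>
    have h : x ^ (d + 1) ≤ (x + 1) ^ (d + 1) := by gcongr; linarith
    have h2 := mul_le_mul_of_nonneg_right ih (by linarith : (0 : ℝ) ≤ x + 1)
    push_cast at h2 ⊢
    calc (x + 1) ^ (d + 1 + 1) - x ^ (d + 1 + 1)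
        = ((x + 1) ^ (d + 1) - x ^ (d + 1)) * (x + 1) + x ^ (d + 1) := by ring
      _ ≤ (d + 1) * (x + 1) ^ d * (x + 1) + (x + 1) ^ (d + 1) := add_le_add h2 h
      _ = (d + 1 + 1) * (x + 1) ^ (d + 1) := by ring

theorem sum_Icc_mul_pow_sub_pow (c : ℝ) (d j : ℕ) :
    ∑ i ∈ Finset.Icc 1 j, c * ((i : ℝ) ^ (d + 1) - ((i : ℝ) - 1) ^ (d + 1)) =
      c * (j : ℝ) ^ (d + 1) := by
  induction j with
  | zero => simp
  | succ j ih =>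
    rw [Finset.sum_Icc_succ_top (by omega), ih]
    push_cast
    rw [add_sub_cancel_right]
    ring

theorem sum_comparison_polynomial_growth (D : ℕ) (hD : 1 ≤ D)
    (z Z : ℝ) (hz : 0 < z) (hzZ : z ≤ Z) :
    ∃ z' Z' : ℝ, 0 < z' ∧ 0 < Z' ∧
      ∀ a b : ℕ → ℝ,
        (∀ j : ℕ, 1 ≤ j →
          z * (j : ℝ) ^ D ≤ ∑ i ∈ Finset.Icc 1 j, b i ∧
          ∑ i ∈ Finset.Icc 1 j, b i ≤ Z * (j : ℝ) ^ D) →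
        (∀ i : ℕ, 0 < a i) → (Antitone a) →
        ∀ n m : ℕ, 1 ≤ n → n ≤ m →
          (∑ i ∈ Finset.Icc n m, z' * a i * (i : ℝ) ^ (D - 1)) -
              a (n - 1) * (Z - z) * ((n : ℝ) - 1) ^ D ≤
            ∑ i ∈ Finset.Icc n m, a i * b i ∧
          ∑ i ∈ Finset.Icc n m, a i * b i ≤
            (∑ i ∈ Finset.Icc n m, Z' * a i * (i : ℝ) ^ (D - 1)) +
              a (n - 1) * (Z - z) * ((n : ℝ) - 1) ^ D := by
  obtain ⟨d, rfl⟩ : ∃ d, D = d + 1 := ⟨D - 1, by omega⟩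
  have hZ : 0 < Z := hz.trans_le hzZ
  refine ⟨z, Z * (d + 1 : ℕ), hz, by positivity, fun a b hb ha0 ha n m hn hnm => ?_⟩
  obtain ⟨k, rfl⟩ : ∃ k, n = k + 1 := ⟨n - 1, by omega⟩
  have hB : ∀ j : ℕ, z * (j : ℝ) ^ (d + 1) ≤ ∑ i ∈ Finset.Icc 1 j, b i ∧
      ∑ i ∈ Finset.Icc 1 j, b i ≤ Z * (j : ℝ) ^ (d + 1) := by
    intro j
    rcases Nat.eq_zero_or_pos j with rfl | hj
    · simp
    · exact hb j hj
  have hkm : k ≤ m := by omega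
  have ha0' : ∀ i, 0 ≤ a i := fun i => (ha0 i).le
  have lower := sum_mul_le_sum_mul_add ha ha0' (d := b)
    (b := fun i => z * ((i : ℝ) ^ (d + 1) - ((i : ℝ) - 1) ^ (d + 1)))
    (fun j => by rw [sum_Icc_mul_pow_sub_pow]; exact (hB j).1) hkm
  have upper := sum_mul_le_sum_mul_add ha ha0' (b := b)
    (d := fun i => Z * ((i : ℝ) ^ (d + 1) - ((i : ℝ) - 1) ^ (d + 1)))
    (fun j => by rw [sum_Icc_mul_pow_sub_pow]; exact (hB j).2) hkm
  rw [sum_Icc_mul_pow_sub_pow] at lower upper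
  have hpred : ∀ i ∈ Finset.Icc (k + 1) m, (0 : ℝ) ≤ (i : ℝ) - 1 := fun i hi => by
    have : 1 ≤ i := by have := Finset.mem_Icc.1 hi; omega
    exact sub_nonneg.2 (by exact_mod_cast this)
  have lower_terms : ∑ i ∈ Finset.Icc (k + 1) m, z * a i * (i : ℝ) ^ d ≤
      ∑ i ∈ Finset.Icc (k + 1) m, a i * (z * ((i : ℝ) ^ (d + 1) - ((i : ℝ) - 1) ^ (d + 1))) := by
    refine Finset.sum_le_sum fun i hi => ?_
    have h := pow_le_add_one_pow_succ_sub (hpred i hi) d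
    rw [sub_add_cancel] at h
    have := mul_le_mul_of_nonneg_left h (mul_nonneg hz.le (ha0' i))
    linarith
  have upper_terms :
      ∑ i ∈ Finset.Icc (k + 1) m, a i * (Z * ((i : ℝ) ^ (d + 1) - ((i : ℝ) - 1) ^ (d + 1))) ≤
      ∑ i ∈ Finset.Icc (k + 1) m, Z * (d + 1 : ℕ) * a i * (i : ℝ) ^ d := by
    refine Finset.sum_le_sum fun i hi => ?_
    have h := add_one_pow_succ_sub_le (hpred i hi) d
    rw [sub_add_cancel] at h
    have := mul_le_mul_of_nonneg_left h (mul_nonneg hZ.le (ha0' i))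
    linarith
  have boundary_lower := mul_le_mul_of_nonneg_left (hB k).1 (ha0' k)
  have boundary_upper := mul_le_mul_of_nonneg_left (hB k).2 (ha0' k)
  have hk : ((k + 1 : ℕ) : ℝ) - 1 = k := by push_cast; ring
  rw [hk]
  simp only [Nat.add_sub_cancel]
  constructor <;> linarith
end

section
/- Let G be a group with a fixed finite presentation, and fix for each pair x, y ∈ G a geodesic word γ_{x,y} from x to y with γ_{y,x} the reverse of γ_{x,y}; let Δ(x,y,z) = δ(γ_{x,y}γ_{y,z}γ_{z,x}). Then there is a constant c (depending only on the presentation) such that for every closed lazy word w of length n, writing w_{i,j} = w(⌊j·n/2^i⌋), the filling area satisfies δ(w) ≤ c·n + Σ_{i=1}^{⌊log₂ n⌋} Σ_{j=0}^{2^i − 1} Δ(w_{i,j}, w_{i+1,2j+1}, w_{i,j+1}). -/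
/-!
Statement 15: Let `G` have a fixed finite presentation, with fixed geodesic words
`γ_{x,y}` and `Δ(x,y,z)` the filling area of the geodesic triangle on `x, y, z`.  Then
there is a constant `c` (depending only on the presentation) such that every closed lazy
word `w` of length `n` satisfies, with `w_{i,j} = w(⌊j·n/2^i⌋)`,
`δ(w) ≤ c·n + Σ_{i=1}^{⌊log₂ n⌋} Σ_{j=0}^{2^i−1} Δ(w_{i,j}, w_{i+1,2j+1}, w_{i,j+1})`.
-/

namespace AvgDehnPaper

variable {d s : ℕ}

/-- The normal closure of the relators: `R ⊆ F`. -/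
def relSubgroup (r : Fin s → FreeGroup (Fin d)) : Subgroup (FreeGroup (Fin d)) :=
  Subgroup.normalClosure (Set.range r)

instance (r : Fin s → FreeGroup (Fin d)) : (relSubgroup r).Normal :=
  Subgroup.normalClosure_normal

/-- The filling area `δ(w)` of a word `w` representing the identity: the least `k` such
that `w` is a product of `k` conjugates of relators (or their inverses) in `F`. -/
noncomputable def fillingArea (r : Fin s → FreeGroup (Fin d)) (w : FreeGroup (Fin d)) : ℕ :=
  sInf { k | ∃ (g : Fin k → FreeGroup (Fin d)) (a : Fin k → Fin s) (ε : Fin k → Bool),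
    w = (List.ofFn (fun i => (g i)⁻¹ * (r (a i)) ^ (if ε i then (1 : ℤ) else -1) * g i)).prod }

/-- The Dehn function `δ(n)`: the maximal filling area over words of length at most `n`
representing the identity. -/
noncomputable def dehn (r : Fin s → FreeGroup (Fin d)) (n : ℕ) : ℕ :=
  sSup { A | ∃ w ∈ relSubgroup r, FreeGroup.norm w ≤ n ∧ A = fillingArea r w }

/-- A lazy letter: either the identity (`none`) or a generator or its inverse. -/
abbrev Letter (d : ℕ) := Option (Fin d × Bool)

/-- The value of a lazy letter in the free group. -/
def letterVal : Letter d → FreeGroup (Fin d)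
  | none => 1
  | some (i, b) => if b then FreeGroup.of i else (FreeGroup.of i)⁻¹

/-- The element of the free group spelled by the first `t` letters of a lazy word. -/
def partialProd {n : ℕ} (w : Fin n → Letter d) (t : ℕ) : FreeGroup (Fin d) :=
  (((List.ofFn w).take t).map letterVal).prod

open scoped Classical in
/-- The (finite, nonempty) set of lazy words of length `n` representing the identity in `G`. -/
noncomputable def closedWords (r : Fin s → FreeGroup (Fin d)) (n : ℕ) :
    Finset (Fin n → Letter d) :=
  Finset.univ.filter (fun w => partialProd w n ∈ relSubgroup r)

/-- The averaged Dehn function: the average of `δ(w)` over all lazy words of length `n`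
representing the identity, with respect to the uniform measure. -/
noncomputable def avgDehn (r : Fin s → FreeGroup (Fin d)) (n : ℕ) : ℝ :=
  (∑ w ∈ closedWords r n, (fillingArea r (partialProd w n) : ℝ)) /
    ((closedWords r n).card : ℝ)

/-- The word metric on `G = F/R` induced by the generators `e_1, …, e_d`. -/
noncomputable def genDist (r : Fin s → FreeGroup (Fin d))
    (x y : FreeGroup (Fin d) ⧸ relSubgroup r) : ℕ :=
  sInf { m | ∃ u : FreeGroup (Fin d), FreeGroup.norm u = m ∧
    QuotientGroup.mk' (relSubgroup r) u = x⁻¹ * y }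

/-- The position in `G` of the path spelled by a lazy word after `t` steps. -/
def quotPos (r : Fin s → FreeGroup (Fin d)) {n : ℕ} (w : Fin n → Letter d) (t : ℕ) :
    FreeGroup (Fin d) ⧸ relSubgroup r :=
  QuotientGroup.mk' (relSubgroup r) (partialProd w t)

/-- `Δ(x,y,z)`: the filling area of the geodesic triangle `γ_{x,y}γ_{y,z}γ_{z,x}`. -/
noncomputable def triArea (r : Fin s → FreeGroup (Fin d))
    (γ : (FreeGroup (Fin d) ⧸ relSubgroup r) → (FreeGroup (Fin d) ⧸ relSubgroup r) →
      FreeGroup (Fin d))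
    (x y z : FreeGroup (Fin d) ⧸ relSubgroup r) : ℕ :=
  fillingArea r (γ x y * γ y z * γ z x)

/-- The number `k` of conjugates of relators (or their inverses) suffices to write `w`. -/
def FilledBy (r : Fin s → FreeGroup (Fin d)) (k : ℕ) (w : FreeGroup (Fin d)) : Prop :=
  ∃ l : List (FreeGroup (Fin d)), l.length = k ∧
    (∀ x ∈ l, ∃ (g : FreeGroup (Fin d)) (a : Fin s) (ε : Bool),
      x = g⁻¹ * (r a) ^ (if ε then (1 : ℤ) else -1) * g) ∧ w = l.prod

lemma fillingArea_eq_sInf (r : Fin s → FreeGroup (Fin d)) (w : FreeGroup (Fin d)) :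
    fillingArea r w = sInf {k | FilledBy r k w} := by
  unfold fillingArea
  congr 1
  ext k
  constructor
  · rintro ⟨g, a, ε, h⟩
    refine ⟨_, List.length_ofFn, ?_, h⟩
    intro x hx
    obtain ⟨i, rfl⟩ := (List.mem_ofFn' _ _).1 hx
    exact ⟨g i, a i, ε i, rfl⟩
  · rintro ⟨l, rfl, hl, h⟩
    choose g a ε hx using fun i : Fin l.length => hl (l.get i) (l.get_mem i)
    refine ⟨g, a, ε, ?_⟩
    simp only [← hx]
    rw [h, List.ofFn_get]

lemma FilledBy.fillingArea_le {r : Fin s → FreeGroup (Fin d)} {k : ℕ} {w : FreeGroup (Fin d)}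
    (h : FilledBy r k w) : fillingArea r w ≤ k := by
  rw [fillingArea_eq_sInf]
  exact Nat.sInf_le h

lemma FilledBy.mul {r : Fin s → FreeGroup (Fin d)} {k m : ℕ} {u v : FreeGroup (Fin d)}
    (hu : FilledBy r k u) (hv : FilledBy r m v) : FilledBy r (k + m) (u * v) := by
  obtain ⟨l, rfl, hl, rfl⟩ := hu
  obtain ⟨l', rfl, hl', rfl⟩ := hv
  refine ⟨l ++ l', List.length_append, ?_, by simp⟩
  intro x hx
  exact (List.mem_append.1 hx).elim (hl x) (hl' x)

lemma FilledBy.conj {r : Fin s → FreeGroup (Fin d)} {k : ℕ} {w : FreeGroup (Fin d)}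
    (h : FilledBy r k w) (u : FreeGroup (Fin d)) : FilledBy r k (u * w * u⁻¹) := by
  obtain ⟨l, rfl, hl, rfl⟩ := h
  refine ⟨l.map (MulAut.conj u), by simp, ?_, ?_⟩
  · intro x hx
    obtain ⟨y, hy, rfl⟩ := List.mem_map.1 hx
    obtain ⟨g, a, ε, rfl⟩ := hl y hy
    exact ⟨g * u⁻¹, a, ε, by simp only [MulAut.conj_apply]; group⟩
  · rw [← map_list_prod, MulAut.conj_apply]

lemma FilledBy.one (r : Fin s → FreeGroup (Fin d)) : FilledBy r 0 1 :=
  ⟨[], rfl, by simp, rfl⟩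

lemma FilledBy.inv {r : Fin s → FreeGroup (Fin d)} {k : ℕ} {w : FreeGroup (Fin d)}
    (h : FilledBy r k w) : FilledBy r k w⁻¹ := by
  obtain ⟨l, rfl, hl, rfl⟩ := h
  refine ⟨(l.map (·⁻¹)).reverse, by simp, ?_, List.prod_inv_reverse l⟩
  intro x hx
  obtain ⟨y, hy, rfl⟩ := List.mem_map.1 (List.mem_reverse.1 hx)
  obtain ⟨g, a, ε, rfl⟩ := hl y hy
  refine ⟨g, a, !ε, ?_⟩
  cases ε <;> simp [mul_assoc]

lemma exists_filledBy {r : Fin s → FreeGroup (Fin d)} {w : FreeGroup (Fin d)}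
    (h : w ∈ relSubgroup r) : ∃ k, FilledBy r k w := by
  let H : Subgroup (FreeGroup (Fin d)) :=
    { carrier := {w | ∃ k, FilledBy r k w}
      mul_mem' := fun ⟨_, h⟩ ⟨_, h'⟩ => ⟨_, h.mul h'⟩
      one_mem' := ⟨_, FilledBy.one r⟩
      inv_mem' := fun ⟨_, h⟩ => ⟨_, h.inv⟩ }
  have : H.Normal := ⟨fun _ ⟨k, hk⟩ u => ⟨k, hk.conj u⟩⟩
  refine Subgroup.normalClosure_le_normal (N := H) ?_ h
  rintro _ ⟨a, rfl⟩
  exact ⟨1, [r a], rfl, fun x hx => ⟨1, a, true, by simpa using hx⟩, by simp⟩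

lemma filledBy_fillingArea {r : Fin s → FreeGroup (Fin d)} {w : FreeGroup (Fin d)}
    (h : w ∈ relSubgroup r) : FilledBy r (fillingArea r w) w := by
  rw [fillingArea_eq_sInf]
  exact Nat.sInf_mem (exists_filledBy h)

lemma fillingArea_one (r : Fin s → FreeGroup (Fin d)) : fillingArea r 1 = 0 :=
  Nat.le_zero.1 (FilledBy.one r).fillingArea_le

lemma fillingArea_mul_le {r : Fin s → FreeGroup (Fin d)} {u v : FreeGroup (Fin d)}
    (hu : u ∈ relSubgroup r) (hv : v ∈ relSubgroup r) :
    fillingArea r (u * v) ≤ fillingArea r u + fillingArea r v :=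
  ((filledBy_fillingArea hu).mul (filledBy_fillingArea hv)).fillingArea_le

lemma fillingArea_conj_le {r : Fin s → FreeGroup (Fin d)} {w : FreeGroup (Fin d)}
    (h : w ∈ relSubgroup r) (u : FreeGroup (Fin d)) :
    fillingArea r (u * w * u⁻¹) ≤ fillingArea r w :=
  ((filledBy_fillingArea h).conj u).fillingArea_le

/-- The ordered product `f 0 * f 1 * ⋯ * f (m - 1)`. -/
def rangeProd {M : Type*} [Monoid M] (f : ℕ → M) (m : ℕ) : M :=
  ((List.range m).map f).prod

lemma rangeProd_zero {M : Type*} [Monoid M] (f : ℕ → M) : rangeProd f 0 = 1 := rfl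

lemma rangeProd_succ {M : Type*} [Monoid M] (f : ℕ → M) (m : ℕ) :
    rangeProd f (m + 1) = rangeProd f m * f m := by
  simp [rangeProd, List.range_succ]

lemma rangeProd_two_mul {M : Type*} [Monoid M] (f : ℕ → M) (m : ℕ) :
    rangeProd f (2 * m) = rangeProd (fun j => f (2 * j) * f (2 * j + 1)) m := by
  induction m with
  | zero => rfl
  | succ m ih => rw [rangeProd_succ, ← ih, Nat.mul_succ, rangeProd_succ, rangeProd_succ, mul_assoc]

lemma rangeProd_inv_mul_succ {G : Type*} [Group G] (f : ℕ → G) (m : ℕ) :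
    rangeProd (fun j => (f j)⁻¹ * f (j + 1)) m = (f 0)⁻¹ * f m := by
  induction m with
  | zero => simp [rangeProd_zero]
  | succ m ih => rw [rangeProd_succ, ih]; group

lemma rangeProd_comparison {r : Fin s → FreeGroup (Fin d)} {a b : ℕ → FreeGroup (Fin d)}
    (h : ∀ j, a j * (b j)⁻¹ ∈ relSubgroup r) (m : ℕ) :
    rangeProd a m * (rangeProd b m)⁻¹ ∈ relSubgroup r ∧
      fillingArea r (rangeProd a m * (rangeProd b m)⁻¹) ≤
        ∑ j ∈ Finset.range m, fillingArea r (a j * (b j)⁻¹) := by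
  induction m with
  | zero => simp [rangeProd_zero, fillingArea_one, one_mem]
  | succ m ih =>
    have key : rangeProd a (m + 1) * (rangeProd b (m + 1))⁻¹ =
        (rangeProd a m * (rangeProd b m)⁻¹) *
          (rangeProd b m * (a m * (b m)⁻¹) * (rangeProd b m)⁻¹) := by
      rw [rangeProd_succ, rangeProd_succ]; group
    have hc : rangeProd b m * (a m * (b m)⁻¹) * (rangeProd b m)⁻¹ ∈ relSubgroup r :=
      Subgroup.Normal.conj_mem inferInstance _ (h m) _
    rw [key, Finset.sum_range_succ]
    exact ⟨mul_mem ih.1 hc, (fillingArea_mul_le ih.1 hc).trans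
      (add_le_add ih.2 (fillingArea_conj_le (h m) _))⟩

lemma fillingArea_rangeProd_le {r : Fin s → FreeGroup (Fin d)} {a b : ℕ → FreeGroup (Fin d)}
    (h : ∀ j, a j * (b j)⁻¹ ∈ relSubgroup r) (m : ℕ) (hb : rangeProd b m ∈ relSubgroup r) :
    rangeProd a m ∈ relSubgroup r ∧ fillingArea r (rangeProd a m) ≤
      ∑ j ∈ Finset.range m, fillingArea r (a j * (b j)⁻¹) + fillingArea r (rangeProd b m) := by
  obtain ⟨h₁, h₂⟩ := rangeProd_comparison h m
  have key : rangeProd a m = rangeProd a m * (rangeProd b m)⁻¹ * rangeProd b m := by group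
  refine ⟨key ▸ mul_mem h₁ hb, ?_⟩
  calc fillingArea r (rangeProd a m)
      = fillingArea r (rangeProd a m * (rangeProd b m)⁻¹ * rangeProd b m) := by rw [← key]
    _ ≤ _ := (fillingArea_mul_le h₁ hb).trans (Nat.add_le_add_right h₂ _)

lemma norm_letterVal_le (l : Letter d) : FreeGroup.norm (letterVal l) ≤ 1 := by
  rcases l with _ | ⟨i, b⟩
  · simp [letterVal]
  · cases b <;> simp [letterVal, FreeGroup.norm_inv_eq]

lemma exists_letterVal_eq {u : FreeGroup (Fin d)} (h : FreeGroup.norm u ≤ 1) :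
    ∃ l : Letter d, letterVal l = u := by
  rw [← FreeGroup.mk_toWord (x := u)]
  unfold FreeGroup.norm at h
  match u.toWord, h with
  | [], _ => exact ⟨none, rfl⟩
  | [(i, b)], _ => refine ⟨some (i, b), ?_⟩; cases b <;> rfl
  | _ :: _ :: _, h => simp at h

lemma partialProd_zero {n : ℕ} (w : Fin n → Letter d) : partialProd w 0 = 1 := rfl

lemma partialProd_succ {n : ℕ} (w : Fin n → Letter d) {t : ℕ} (ht : t < n) :
    partialProd w (t + 1) = partialProd w t * letterVal (w ⟨t, ht⟩) := by
  simp [partialProd, List.take_add_one, ht]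

lemma genDist_le (r : Fin s → FreeGroup (Fin d)) {x y : FreeGroup (Fin d) ⧸ relSubgroup r}
    {u : FreeGroup (Fin d)} (h : QuotientGroup.mk' (relSubgroup r) u = x⁻¹ * y) :
    genDist r x y ≤ FreeGroup.norm u :=
  Nat.sInf_le ⟨u, rfl, h⟩

theorem subdivision_filling_bound {d s : ℕ} (r : Fin s → FreeGroup (Fin d))
    (γ : (FreeGroup (Fin d) ⧸ relSubgroup r) → (FreeGroup (Fin d) ⧸ relSubgroup r) →
      FreeGroup (Fin d))
    (hγval : ∀ x y, QuotientGroup.mk' (relSubgroup r) (γ x y) = x⁻¹ * y)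
    (hγgeo : ∀ x y, FreeGroup.norm (γ x y) = genDist r x y)
    (hγsymm : ∀ x y, γ y x = (γ x y)⁻¹) :
    ∃ c : ℕ, ∀ n : ℕ, ∀ w ∈ closedWords r n,
      fillingArea r (partialProd w n) ≤ c * n +
        ∑ i ∈ Finset.Icc 1 (Nat.log 2 n), ∑ j ∈ Finset.range (2 ^ i),
          triArea r γ (quotPos r w (j * n / 2 ^ i))
            (quotPos r w ((2 * j + 1) * n / 2 ^ (i + 1)))
            (quotPos r w ((j + 1) * n / 2 ^ i)) := by
  have hmem : ∀ u : FreeGroup (Fin d),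
      QuotientGroup.mk' (relSubgroup r) u = 1 → u ∈ relSubgroup r := fun u hu => by
    rwa [← MonoidHom.mem_ker, QuotientGroup.ker_mk'] at hu
  have hself : ∀ x, γ x x = 1 := fun x => by
    rw [← FreeGroup.norm_eq_zero, hγgeo, ← Nat.le_zero, ← FreeGroup.norm_one (α := Fin d)]
    exact genDist_le r (by simp)
  obtain ⟨c, hc⟩ : ∃ c, ∀ p : Letter d × Letter d,
      fillingArea r (letterVal p.1 * (letterVal p.2)⁻¹) ≤ c :=
    ⟨_, fun p => Finset.le_sup
      (f := fun p : Letter d × Letter d => fillingArea r (letterVal p.1 * (letterVal p.2)⁻¹))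
      (Finset.mem_univ p)⟩
  refine ⟨c, fun n w hw => ?_⟩
  have hclosed : partialProd w n ∈ relSubgroup r := by
    simpa [closedWords] using hw
  have hend : quotPos r w n = quotPos r w 0 := by
    unfold quotPos
    rw [partialProd_zero, map_one, ← MonoidHom.mem_ker, QuotientGroup.ker_mk']
    exact hclosed
  let t : ℕ → ℕ → ℕ := fun i j => j * n / 2 ^ i
  let path : ℕ → ℕ → FreeGroup (Fin d) := fun i j =>
    γ (quotPos r w (t i j)) (quotPos r w (t i (j + 1)))
  have ht0 : ∀ i, t i 0 = 0 := fun i => by simp [t]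
  have htend : ∀ i, t i (2 ^ i) = n := fun i => Nat.mul_div_cancel_left n (by positivity)
  have hteven : ∀ i j, t (i + 1) (2 * j) = t i j := fun i j => by
    simp only [t]
    rw [pow_succ', mul_assoc, Nat.mul_div_mul_left _ _ two_pos]
  have hlevel : ∀ i, rangeProd (path (i + 1)) (2 ^ (i + 1)) ∈ relSubgroup r ∧
      fillingArea r (rangeProd (path (i + 1)) (2 ^ (i + 1))) ≤
        ∑ i ∈ Finset.Icc 1 i, ∑ j ∈ Finset.range (2 ^ i),
          triArea r γ (quotPos r w (t i j)) (quotPos r w (t (i + 1) (2 * j + 1)))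
            (quotPos r w (t i (j + 1))) := by
    intro i
    induction i with
    | zero =>
      have h2 : t 1 2 = n := htend 1
      have : rangeProd (path (0 + 1)) (2 ^ (0 + 1)) = 1 := by
        simp [rangeProd, List.range_succ, path, ht0, h2, hend, hγsymm (quotPos r w 0)]
      rw [this]
      simp [fillingArea_one, one_mem]
    | succ i ih =>
      have htri : ∀ j, path (i + 1 + 1) (2 * j) * path (i + 1 + 1) (2 * j + 1) *
          (path (i + 1) j)⁻¹ =
          γ (quotPos r w (t (i + 1) j)) (quotPos r w (t (i + 1 + 1) (2 * j + 1))) *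
          γ (quotPos r w (t (i + 1 + 1) (2 * j + 1))) (quotPos r w (t (i + 1) (j + 1))) *
          γ (quotPos r w (t (i + 1) (j + 1))) (quotPos r w (t (i + 1) j)) := fun j => by
        simp only [path]
        rw [← hγsymm, hteven, show 2 * j + 1 + 1 = 2 * (j + 1) by ring, hteven]
      rw [pow_succ' 2 (i + 1), rangeProd_two_mul, Finset.sum_Icc_succ_top (by omega),
        add_comm (∑ i ∈ Finset.Icc 1 i, _)]
      have hstep := fillingArea_rangeProd_le (r := r)
        (a := fun j => path (i + 1 + 1) (2 * j) * path (i + 1 + 1) (2 * j + 1))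
        (b := path (i + 1)) (fun j => hmem _ (by
          rw [htri]; simp only [map_mul, hγval]; group)) (2 ^ (i + 1)) ih.1
      refine ⟨hstep.1, hstep.2.trans (add_le_add (le_of_eq ?_) ih.2)⟩
      exact Finset.sum_congr rfl fun j _ => by rw [htri]; rfl
  let L := Nat.log 2 n
  let N := 2 ^ (L + 1)
  have hN : n < N := Nat.lt_pow_succ_log_self one_lt_two n
  have htstep : ∀ j, t (L + 1) (j + 1) = t (L + 1) j ∨ t (L + 1) (j + 1) = t (L + 1) j + 1 := by
    intro j
    have hpos : 0 < N := by omega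
    have h₁ : t (L + 1) j ≤ t (L + 1) (j + 1) := Nat.div_le_div_right (by gcongr; omega)
    have h₂ : t (L + 1) (j + 1) ≤ t (L + 1) j + 1 := by
      rw [← Nat.add_div_right _ hpos]
      exact Nat.div_le_div_right (by rw [Nat.succ_mul]; omega)
    omega
  have hmono : ∀ j ≤ N, t (L + 1) j ≤ n := fun j hj => by
    rw [← htend (L + 1)]
    exact Nat.div_le_div_right (by gcongr)
  let seg : ℕ → FreeGroup (Fin d) := fun j =>
    (partialProd w (t (L + 1) j))⁻¹ * partialProd w (t (L + 1) (j + 1))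
  have hseg : ∀ j, seg j * (path (L + 1) j)⁻¹ ∈ relSubgroup r := fun j => hmem _ (by
    simp only [seg, path, map_mul, map_inv, hγval, quotPos]; group)
  have hcost : ∀ j ∈ Finset.range N, fillingArea r (seg j * (path (L + 1) j)⁻¹) ≤
      c * (t (L + 1) (j + 1) - t (L + 1) j) := by
    intro j hj
    rcases htstep j with h | h
    · simp [seg, path, h, hself, fillingArea_one]
    · have hlt : t (L + 1) j < n := by
        have := hmono (j + 1) (Finset.mem_range.1 hj)
        omega
      have hs : seg j = letterVal (w ⟨_, hlt⟩) := by
        simp only [seg, h]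
        rw [partialProd_succ w hlt, inv_mul_cancel_left]
      obtain ⟨l, hl⟩ := exists_letterVal_eq (u := path (L + 1) j) <| by
        simp only [path]
        rw [hγgeo]
        refine (genDist_le r (u := seg j) ?_).trans (hs ▸ norm_letterVal_le _)
        simp only [seg, quotPos, map_mul, map_inv]
      rw [hs, ← hl, h, Nat.add_sub_cancel_left, mul_one]
      exact hc (_, l)
  have htotal : rangeProd seg N = partialProd w n := by
    simp only [seg]
    rw [rangeProd_inv_mul_succ (fun j => partialProd w (t (L + 1) j)), ht0, partialProd_zero,
      htend, inv_one, one_mul]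
  have hsum : ∑ j ∈ Finset.range N, (t (L + 1) (j + 1) - t (L + 1) j) = n := by
    rw [Finset.sum_range_tsub (monotone_nat_of_le_succ fun j => by have := htstep j; omega),
      htend, ht0, Nat.sub_zero]
  rw [← htotal]
  refine (fillingArea_rangeProd_le hseg N (hlevel L).1).2.trans (add_le_add ?_ (hlevel L).2)
  calc _ ≤ ∑ j ∈ Finset.range N, c * (t (L + 1) (j + 1) - t (L + 1) j) := Finset.sum_le_sum hcost
    _ = c * n := by rw [← Finset.mul_sum, hsum]

end AvgDehnPaper
end
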